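/- arXiv:2411.13765 — 7 statements merged into one kernel-verified Lean document; each statement's English description precedes it below -/
import Mathlib

section
/- Existence for the static Schrödinger bridge problem: let ρ0, ρT be Borel probability measures on ℝ^n and R a Borel probability measure on ℝ^n × ℝ^n. If there exists some π ∈ Π(ρ0, ρT) with KL(π‖R) < ∞, then the infimum of π ↦ KL(π‖R) over Π(ρ0, ρT) is attained by some π̂ ∈ Π(ρ0, ρT) (which is then unique). -/
open MeasureTheory Classical

/-- Kullback–Leibler divergence: `∫ log (dμ/dν) dμ` if `μ ≪ ν` (and the
integral is well defined), `+∞` otherwise. -/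
noncomputable def KL {α : Type*} [MeasurableSpace α] (μ ν : Measure α) : EReal :=
  if μ ≪ ν ∧ Integrable (fun x => Real.log ((μ.rnDeriv ν x).toReal)) μ
  then ((∫ x, Real.log ((μ.rnDeriv ν x).toReal) ∂μ : ℝ) : EReal) else ⊤

/-- The set `Π(ρ0, ρT)` of couplings of `ρ0` and `ρT`. -/
def Coupling {n : ℕ} (ρ0 ρT : Measure (Fin n → ℝ)) :
    Set (Measure ((Fin n → ℝ) × (Fin n → ℝ))) :=
  {π | IsProbabilityMeasure π ∧ π.map Prod.fst = ρ0 ∧ π.map Prod.snd = ρT}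

open scoped ENNReal Topology
open Filter InformationTheory

theorem two_mul_sub_two_mul_sqrt_mul_sqrt_le {a m : ℝ} (ha : 0 ≤ a) (hm : 0 < m) :
    2 * a - 2 * (√a * √m) ≤ a * Real.log a - a * Real.log m := by
  obtain rfl | ha := ha.eq_or_lt
  · simp
  have hx : 0 < √a := Real.sqrt_pos.2 ha
  have hy : 0 < √m := Real.sqrt_pos.2 hm
  have h := Real.log_le_sub_one_of_pos (div_pos hy hx)
  rw [Real.log_div hy.ne' hx.ne', Real.log_sqrt hm.le, Real.log_sqrt ha.le] at h
  have h' := mul_le_mul_of_nonneg_left h (mul_pos two_pos ha).le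
  have e : a * (√m / √a) = √a * √m := by
    nth_rewrite 1 [← Real.mul_self_sqrt ha.le]
    field_simp
  nlinarith

/-- A quantitative form of the strict convexity of `klFun`. -/
theorem sq_sqrt_sub_sqrt_add_klFun_le {a b : ℝ} (ha : 0 ≤ a) (hb : 0 ≤ b) :
    (√a - √b) ^ 2 / 2 + 2 * klFun ((a + b) / 2) ≤ klFun a + klFun b := by
  obtain hm | hm := (show 0 ≤ (a + b) / 2 by positivity).eq_or_lt
  · obtain rfl : a = 0 := by linarith
    obtain rfl : b = 0 := by linarith
    simp [klFun]
    norm_num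
  have h1 := two_mul_sub_two_mul_sqrt_mul_sqrt_le ha hm
  have h2 := two_mul_sub_two_mul_sqrt_mul_sqrt_le hb hm
  simp only [klFun]
  have e1 := Real.sq_sqrt ha
  have e2 := Real.sq_sqrt hb
  have e3 := Real.sq_sqrt hm.le
  set m := (a + b) / 2 with hmdef
  have hab : a + b = 2 * m := by rw [hmdef]; ring
  have e4 : a * Real.log m + b * Real.log m = 2 * (m * Real.log m) := by
    rw [← add_mul, hab]; ring
  nlinarith [sq_nonneg (√a + √b - 2 * √m)]

section

variable {α : Type*} [MeasurableSpace α]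

theorem eLpNorm_two_sq_eq_lintegral (f : α → ℝ) (μ : Measure α) :
    eLpNorm f 2 μ ^ 2 = ∫⁻ x, ENNReal.ofReal (f x ^ 2) ∂μ := by
  have h := eLpNorm_nnreal_pow_eq_lintegral (μ := μ) (f := f) (p := 2) two_ne_zero
  simp only [NNReal.coe_ofNat, ENNReal.rpow_ofNat, ENNReal.coe_ofNat] at h
  rw [h]
  refine lintegral_congr fun x => ?_
  rw [Real.enorm_eq_ofReal_abs, ← ENNReal.ofReal_pow (abs_nonneg _), sq_abs]

theorem tendsto_eLpNorm_of_tendsto_eLpNorm_sub {ι : Type*} {l : Filter ι} {μ : Measure α}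
    {p : ℝ≥0∞} (hp : 1 ≤ p) {f : ι → α → ℝ} {g : α → ℝ}
    (hf : ∀ i, AEStronglyMeasurable (f i) μ) (hg : MemLp g p μ)
    (h : Tendsto (fun i => eLpNorm (f i - g) p μ) l (𝓝 0)) :
    Tendsto (fun i => eLpNorm (f i) p μ) l (𝓝 (eLpNorm g p μ)) := by
  have hlow : Tendsto (fun i => eLpNorm g p μ - eLpNorm (f i - g) p μ) l
      (𝓝 (eLpNorm g p μ)) := by
    simpa using ENNReal.Tendsto.sub (tendsto_const_nhds (x := eLpNorm g p μ)) h
      (Or.inl hg.eLpNorm_ne_top)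
  have hup : Tendsto (fun i => eLpNorm g p μ + eLpNorm (f i - g) p μ) l
      (𝓝 (eLpNorm g p μ)) := by
    simpa using (tendsto_const_nhds (x := eLpNorm g p μ)).add h
  refine tendsto_of_tendsto_of_tendsto_of_le_of_le hlow hup (fun i => ?_) (fun i => ?_)
  · rw [tsub_le_iff_right]
    have := eLpNorm_add_le (hf i) (hg.1.sub (hf i)) hp
    rwa [add_sub_cancel, eLpNorm_sub_comm] at this
  · have := eLpNorm_add_le hg.1 ((hf i).sub hg.1) hp
    rwa [add_sub_cancel] at this

/-- The square root of the density of `μ` with respect to `ν`. -/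
noncomputable def sqrtDensity (μ ν : Measure α) (x : α) : ℝ := √(μ.rnDeriv ν x).toReal

theorem measurable_sqrtDensity (μ ν : Measure α) : Measurable (sqrtDensity μ ν) :=
  (Measure.measurable_rnDeriv μ ν).ennreal_toReal.sqrt

variable {μ ν R : Measure α}

theorem eLpNorm_sqrtDensity_sq [IsFiniteMeasure μ] [IsFiniteMeasure R] (h : μ ≪ R) {s : Set α}
    (hs : MeasurableSet s) : eLpNorm (sqrtDensity μ R) 2 (R.restrict s) ^ 2 = μ s := by
  rw [eLpNorm_two_sq_eq_lintegral, ← Measure.setLIntegral_rnDeriv' h hs]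
  refine lintegral_congr_ae ?_
  filter_upwards [ae_restrict_of_ae (Measure.rnDeriv_lt_top μ R)] with x hx
  rw [sqrtDensity, Real.sq_sqrt ENNReal.toReal_nonneg, ENNReal.ofReal_toReal hx.ne]

theorem memLp_sqrtDensity [IsFiniteMeasure μ] [IsFiniteMeasure R] (h : μ ≪ R) :
    MemLp (sqrtDensity μ R) 2 R := by
  refine ⟨(measurable_sqrtDensity μ R).aestronglyMeasurable, ?_⟩
  have := eLpNorm_sqrtDensity_sq h MeasurableSet.univ
  rw [Measure.restrict_univ] at this
  by_contra! htop
  rw [top_le_iff.1 htop] at this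
  exact measure_ne_top μ Set.univ (by rw [← this]; simp)

theorem toReal_rnDeriv_midpoint [IsFiniteMeasure μ] [IsFiniteMeasure ν] [IsFiniteMeasure R] :
    ∀ᵐ x ∂ R, (((2⁻¹ : ℝ≥0∞) • (μ + ν)).rnDeriv R x).toReal =
      ((μ.rnDeriv R x).toReal + (ν.rnDeriv R x).toReal) / 2 := by
  filter_upwards [Measure.rnDeriv_smul_left_of_ne_top (μ + ν) R (r := 2⁻¹) (by simp),
    Measure.rnDeriv_add μ ν R, Measure.rnDeriv_lt_top μ R, Measure.rnDeriv_lt_top ν R]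
    with x h1 h2 h3 h4
  rw [h1, Pi.smul_apply, h2, Pi.add_apply, smul_eq_mul, ENNReal.toReal_mul,
    ENNReal.toReal_add h3.ne h4.ne, ENNReal.toReal_inv, ENNReal.toReal_ofNat]
  ring

theorem eLpNorm_sqrtDensity_sub_sq_add_klDiv_le [IsFiniteMeasure μ] [IsFiniteMeasure ν]
    [IsFiniteMeasure R] (hμ : μ ≪ R) (hν : ν ≪ R) :
    eLpNorm (sqrtDensity μ R - sqrtDensity ν R) 2 R ^ 2 / 2 +
      2 * klDiv ((2⁻¹ : ℝ≥0∞) • (μ + ν)) R ≤ klDiv μ R + klDiv ν R := by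
  have hac : (2⁻¹ : ℝ≥0∞) • (μ + ν) ≪ R :=
    (Measure.AbsolutelyContinuous.add_left hμ hν).smul_left _
  have : IsFiniteMeasure ((2⁻¹ : ℝ≥0∞) • (μ + ν)) := Measure.smul_finite _ (by simp)
  have hk : Measurable klFun := measurable_klFun
  have hm (π : Measure α) : Measurable fun x => ENNReal.ofReal (klFun (π.rnDeriv R x).toReal) :=
    (hk.comp (Measure.measurable_rnDeriv π R).ennreal_toReal).ennreal_ofReal
  rw [eLpNorm_two_sq_eq_lintegral, klDiv_eq_lintegral_klFun_of_ac hac,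
    klDiv_eq_lintegral_klFun_of_ac hμ, klDiv_eq_lintegral_klFun_of_ac hν,
    ← lintegral_add_left (hm μ), ← lintegral_const_mul _ (hm _), div_eq_mul_inv,
    ← lintegral_mul_const' _ _ (by simp), ← lintegral_add_right _ ((hm _).const_mul _)]
  refine lintegral_mono_ae ?_
  filter_upwards [toReal_rnDeriv_midpoint (μ := μ) (ν := ν) (R := R)] with x hx
  have ha : 0 ≤ (μ.rnDeriv R x).toReal := ENNReal.toReal_nonneg
  have hb : 0 ≤ (ν.rnDeriv R x).toReal := ENNReal.toReal_nonneg
  have hc : 0 ≤ klFun (((μ.rnDeriv R x).toReal + (ν.rnDeriv R x).toReal) / 2) :=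
    klFun_nonneg (by positivity)
  have h2 : (2 : ℝ≥0∞) = ENNReal.ofReal 2 := by simp
  rw [hx, h2, ← ENNReal.ofReal_inv_of_pos two_pos, ← ENNReal.ofReal_mul (sq_nonneg _),
    ← ENNReal.ofReal_mul zero_le_two,
    ← ENNReal.ofReal_add (by positivity) (by positivity),
    ← ENNReal.ofReal_add (klFun_nonneg ha) (klFun_nonneg hb)]
  exact ENNReal.ofReal_le_ofReal (sq_sqrt_sub_sqrt_add_klFun_le ha hb)

/-- If the square roots of the densities of `u n` converge in `L²(R)`, then `u n` converges setwise
to a measure whose divergence is at most the limit of the divergences. -/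
theorem exists_tendsto_klDiv_le_of_tendsto_eLpNorm [IsFiniteMeasure R] {u : ℕ → Measure α}
    [∀ n, IsFiniteMeasure (u n)] (hu : ∀ n, u n ≪ R) {g : α → ℝ} (hg : MemLp g 2 R)
    (hlim : Tendsto (fun n => eLpNorm (sqrtDensity (u n) R - g) 2 R) atTop (𝓝 0))
    {c : ℝ≥0∞} (hc : Tendsto (fun n => klDiv (u n) R) atTop (𝓝 c)) :
    ∃ μ : Measure α, (∀ s, MeasurableSet s → Tendsto (fun n => u n s) atTop (𝓝 (μ s))) ∧
      klDiv μ R ≤ c := by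
  have hmeas (n : ℕ) : AEStronglyMeasurable (sqrtDensity (u n) R) R :=
    (measurable_sqrtDensity _ _).aestronglyMeasurable
  refine ⟨R.withDensity fun x => ENNReal.ofReal (g x ^ 2), fun s hs => ?_, ?_⟩
  · have h := tendsto_eLpNorm_of_tendsto_eLpNorm_sub (μ := R.restrict s) one_le_two
      (fun n => (hmeas n).restrict) (hg.restrict s)
      (tendsto_of_tendsto_of_tendsto_of_le_of_le tendsto_const_nhds hlim (fun _ => zero_le)
        fun n => eLpNorm_mono_measure _ Measure.restrict_le_self)
    have h2 := ENNReal.Tendsto.pow (n := 2) h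
    simp_rw [fun n => eLpNorm_sqrtDensity_sq (hu n) hs] at h2
    rwa [withDensity_apply _ hs, ← eLpNorm_two_sq_eq_lintegral]
  · obtain ⟨ns, hns, hae⟩ := (tendstoInMeasure_of_tendsto_eLpNorm two_ne_zero hmeas hg.1
      hlim).exists_seq_tendsto_ae
    have hk : Measurable klFun := measurable_klFun
    have : IsFiniteMeasure (R.withDensity fun x => ENNReal.ofReal (g x ^ 2)) :=
      isFiniteMeasure_withDensity (by
        rw [← eLpNorm_two_sq_eq_lintegral]
        exact ENNReal.pow_ne_top hg.eLpNorm_ne_top)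
    rw [klDiv_eq_lintegral_klFun_of_ac (withDensity_absolutelyContinuous _ _)]
    calc _ ≤ ∫⁻ x, liminf (fun i => ENNReal.ofReal (klFun ((u (ns i)).rnDeriv R x).toReal))
          atTop ∂ R := by
          refine lintegral_mono_ae ?_
          filter_upwards [hae, Measure.rnDeriv_withDensity₀ R
            (hg.1.aemeasurable.pow_const 2).ennreal_ofReal] with x hx hd
          rw [hd, ENNReal.toReal_ofReal (sq_nonneg _)]
          refine (Tendsto.liminf_eq ?_).ge
          have := ((ENNReal.continuous_ofReal.comp continuous_klFun).tendsto _).comp (hx.pow 2)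
          simpa [Function.comp_def, sqrtDensity, Real.sq_sqrt ENNReal.toReal_nonneg] using this
      _ ≤ liminf (fun i => ∫⁻ x, ENNReal.ofReal (klFun ((u (ns i)).rnDeriv R x).toReal) ∂ R)
          atTop := lintegral_liminf_le fun i =>
            (hk.comp (Measure.measurable_rnDeriv _ R).ennreal_toReal).ennreal_ofReal
      _ = c := by
          refine Tendsto.liminf_eq ?_
          simp_rw [fun i => (klDiv_eq_lintegral_klFun_of_ac (hu (ns i))).symm]
          exact hc.comp hns.tendsto_atTop

/-- The **I-projection** of `R` exists on any nonempty set of finite measures that is closed under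
midpoints and setwise limits. -/
theorem exists_isMinOn_klDiv [IsFiniteMeasure R] {C : Set (Measure α)} (hne : C.Nonempty)
    (hfin : ∀ μ ∈ C, IsFiniteMeasure μ)
    (hmid : ∀ μ ∈ C, ∀ ν ∈ C, (2⁻¹ : ℝ≥0∞) • (μ + ν) ∈ C)
    (hclosed : ∀ (u : ℕ → Measure α) (μ : Measure α), (∀ n, u n ∈ C) →
      (∀ s, MeasurableSet s → Tendsto (fun n => u n s) atTop (𝓝 (μ s))) → μ ∈ C) :
    ∃ μ ∈ C, IsMinOn (fun π => klDiv π R) C μ := by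
  set I : ℝ≥0∞ := ⨅ π ∈ C, klDiv π R with hI
  have hIle : ∀ π ∈ C, I ≤ klDiv π R := fun π hπ => iInf₂_le π hπ
  by_cases hItop : I = ⊤
  · obtain ⟨μ, hμ⟩ := hne
    exact ⟨μ, hμ, fun π hπ => by simp [top_le_iff.1 (hItop ▸ hIle π hπ)]⟩
  let r : ℝ≥0∞ := 4⁻¹
  have hr0 : r ≠ 0 := by simp [r]
  have hr1 : r < 1 := by simp [r]
  have hδ (n : ℕ) : (r ^ n) ^ 2 ≠ 0 := by positivity
  have hex (n : ℕ) : ∃ π ∈ C, klDiv π R < I + (r ^ n) ^ 2 := by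
    simpa [hI, iInf_lt_iff] using ENNReal.lt_add_right hItop (hδ n)
  choose u huC hu using hex
  have := fun n => hfin _ (huC n)
  have hac (n : ℕ) : u n ≪ R := (klDiv_ne_top_iff.1 (hu n).ne_top).1
  have hu_le {N n : ℕ} (h : N ≤ n) : klDiv (u n) R < I + (r ^ N) ^ 2 :=
    (hu n).trans_le <| by
      gcongr I + ?_ ^ 2
      exact pow_le_pow_of_le_one zero_le hr1.le h
  have hcau (N n m : ℕ) (hn : N ≤ n) (hm : N ≤ m) :
      eLpNorm (sqrtDensity (u n) R - sqrtDensity (u m) R) 2 R < 2 * r ^ N := by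
    have h1 := (eLpNorm_sqrtDensity_sub_sq_add_klDiv_le (hac n) (hac m)).trans_lt
      (ENNReal.add_lt_add (hu_le hn) (hu_le hm))
    have h2 : 2 * I ≤ 2 * klDiv ((2⁻¹ : ℝ≥0∞) • (u n + u m)) R := by
      gcongr
      exact hIle _ (hmid _ (huC n) _ (huC m))
    have h3 := (add_le_add_right h2 _).trans_lt h1
    rw [show I + (r ^ N) ^ 2 + (I + (r ^ N) ^ 2) = 2 * (r ^ N) ^ 2 + 2 * I by ring,
      ENNReal.add_lt_add_iff_right (ENNReal.mul_ne_top (by simp) hItop),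
      ENNReal.div_lt_iff (by simp) (by simp)] at h3
    refine (ENNReal.pow_right_strictMono two_ne_zero).lt_iff_lt.1 (h3.trans_eq ?_)
    ring
  obtain ⟨g, hg, hlim⟩ := Lp.cauchy_complete_eLpNorm one_le_two (fun n => memLp_sqrtDensity (hac n))
    (B := fun N => 2 * r ^ N) (by
      rw [ENNReal.tsum_mul_left, ENNReal.tsum_geometric]
      refine ENNReal.mul_ne_top (by simp) (ENNReal.inv_ne_top.2 ?_)
      exact (tsub_pos_of_lt hr1).ne') hcau
  have hc : Tendsto (fun n => klDiv (u n) R) atTop (𝓝 I) := by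
    have h0 := ENNReal.Tendsto.pow (n := 2) (ENNReal.tendsto_pow_atTop_nhds_zero_of_lt_one hr1)
    have h1 := (tendsto_const_nhds (x := I)).add h0
    rw [zero_pow two_ne_zero, add_zero] at h1
    exact tendsto_of_tendsto_of_tendsto_of_le_of_le tendsto_const_nhds h1
      (fun n => hIle _ (huC n)) fun n => (hu n).le
  obtain ⟨μ, hμ, hle⟩ := exists_tendsto_klDiv_le_of_tendsto_eLpNorm hac hg hlim hc
  exact ⟨μ, hclosed u μ huC hμ, fun π hπ => hle.trans (hIle π hπ)⟩

theorem KL_eq_klDiv [IsProbabilityMeasure μ] [IsProbabilityMeasure R] :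
    KL μ R = (klDiv μ R : EReal) := by
  unfold KL
  split_ifs with h
  · have h0 := integral_llr_add_sub_measure_univ_nonneg h.1 h.2
    have h1 := klDiv_of_ac_of_integrable h.1 h.2
    simp only [probReal_univ, add_sub_cancel_right] at h0 h1
    rw [h1, EReal.coe_ennreal_ofReal, max_eq_left h0]
    rfl
  · rw [klDiv_eq_top_iff.2 fun hac hint => h ⟨hac, hint⟩, EReal.coe_ennreal_top]

end

theorem midpoint_mem_coupling {n : ℕ} {ρ0 ρT : Measure (Fin n → ℝ)}
    {μ ν : Measure ((Fin n → ℝ) × (Fin n → ℝ))} (hμ : μ ∈ Coupling ρ0 ρT)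
    (hν : ν ∈ Coupling ρ0 ρT) : (2⁻¹ : ℝ≥0∞) • (μ + ν) ∈ Coupling ρ0 ρT := by
  obtain ⟨h1, h2, h3⟩ := hμ
  obtain ⟨k1, k2, k3⟩ := hν
  have key {β : Type} [MeasurableSpace β] (ρ : Measure β) : (2⁻¹ : ℝ≥0∞) • (ρ + ρ) = ρ := by
    rw [smul_add, ← add_smul, ENNReal.inv_two_add_inv_two, one_smul]
  refine ⟨⟨?_⟩, ?_, ?_⟩
  · simp [ENNReal.inv_two_add_inv_two]
  · rw [Measure.map_smul, Measure.map_add _ _ measurable_fst, h2, k2, key]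
  · rw [Measure.map_smul, Measure.map_add _ _ measurable_snd, h3, k3, key]

theorem mem_coupling_of_tendsto {n : ℕ} {ρ0 ρT : Measure (Fin n → ℝ)}
    {u : ℕ → Measure ((Fin n → ℝ) × (Fin n → ℝ))} {μ : Measure ((Fin n → ℝ) × (Fin n → ℝ))}
    (hu : ∀ k, u k ∈ Coupling ρ0 ρT)
    (h : ∀ s, MeasurableSet s → Tendsto (fun k => u k s) atTop (𝓝 (μ s))) :
    μ ∈ Coupling ρ0 ρT := by
  refine ⟨⟨?_⟩, Measure.ext fun s hs => ?_, Measure.ext fun s hs => ?_⟩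
  · refine tendsto_nhds_unique (h _ MeasurableSet.univ) ?_
    simp_rw [fun k => (hu k).1.measure_univ]
    exact tendsto_const_nhds
  · rw [Measure.map_apply measurable_fst hs]
    refine tendsto_nhds_unique (h _ (measurable_fst hs)) ?_
    simp_rw [fun k => (Measure.map_apply (μ := u k) measurable_fst hs).symm, fun k => (hu k).2.1]
    exact tendsto_const_nhds
  · rw [Measure.map_apply measurable_snd hs]
    refine tendsto_nhds_unique (h _ (measurable_snd hs)) ?_
    simp_rw [fun k => (Measure.map_apply (μ := u k) measurable_snd hs).symm, fun k => (hu k).2.2]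
    exact tendsto_const_nhds

/-- existence for the static Schrödinger bridge problem: if some
coupling has finite KL divergence to `R`, then the infimum of `π ↦ KL(π‖R)` over
`Π(ρ0,ρT)` is attained. -/
theorem static_SBP_existence {n : ℕ}
    (ρ0 ρT : Measure (Fin n → ℝ))
    [IsProbabilityMeasure ρ0] [IsProbabilityMeasure ρT]
    (R : Measure ((Fin n → ℝ) × (Fin n → ℝ))) [IsProbabilityMeasure R]
    (hex : ∃ π ∈ Coupling ρ0 ρT, KL π R < ⊤) :
    ∃ πhat ∈ Coupling ρ0 ρT, ∀ π ∈ Coupling ρ0 ρT, KL πhat R ≤ KL π R := by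
  obtain ⟨π₀, hπ₀, -⟩ := hex
  obtain ⟨μ, hμ, hmin⟩ := exists_isMinOn_klDiv (R := R) (C := Coupling ρ0 ρT) ⟨π₀, hπ₀⟩
    (fun π hπ => have := hπ.1; inferInstance) (fun _ h _ h' => midpoint_mem_coupling h h')
    (fun _ _ hu h => mem_coupling_of_tendsto hu h)
  refine ⟨μ, hμ, fun π hπ => ?_⟩
  have := hμ.1
  have := hπ.1
  rw [KL_eq_klDiv, KL_eq_klDiv, EReal.coe_ennreal_le_coe_ennreal_iff]
  exact hmin hπ
end

section
/- From dynamic to static Schrödinger bridges: let Ω be a standard Borel space, e : Ω → ℝ^n × ℝ^n measurable, R a probability measure on Ω, and κ a Markov kernel from ℝ^n × ℝ^n to Ω disintegrating R over e (R(A ∩ e⁻¹(B)) = ∫_B κ(u)(A) d(e∗R)(u) for all measurable A, Borel B, and κ(u)(e⁻¹{u}) = 1 for e∗R-a.e. u). If P̂ attains the infimum of KL(·‖R) over {P : e∗P ∈ Π(ρ0, ρT)} and this infimum is finite, then π̂ := e∗P̂ attains the infimum of KL(·‖e∗R) over Π(ρ0, ρT), and the two infima are equal. -/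
open MeasureTheory Classical

open ProbabilityTheory InformationTheory in
/-- For probability measures, `KL` agrees with Mathlib's `klDiv`. -/
lemma KL_eq_coe_klDiv {α : Type*} [MeasurableSpace α] (μ ν : Measure α)
    [IsProbabilityMeasure μ] [IsProbabilityMeasure ν] : KL μ ν = (klDiv μ ν : EReal) := by
  by_cases h : μ ≪ ν ∧ Integrable (llr μ ν) μ
  · have hnonneg : 0 ≤ ∫ x, llr μ ν x ∂μ := by
      simpa using integral_llr_add_sub_measure_univ_nonneg h.1 h.2
    rw [klDiv_of_ac_of_integrable h.1 h.2]
    simp only [probReal_univ, add_sub_cancel_right]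
    rw [EReal.coe_ennreal_ofReal, max_eq_left hnonneg]
    exact if_pos h
  · have htop : klDiv μ ν = ⊤ := by
      rw [klDiv_def]
      exact if_neg h
    rw [htop, EReal.coe_ennreal_top]
    exact if_neg h

/-- If a Markov kernel `κ` is concentrated on the fibres of `e`, then mixing it over `π` yields a
measure whose image under `e` is `π`. -/
lemma map_bind_eq_of_ae_fiber {α β : Type*} [MeasurableSpace α] [MeasurableSpace β]
    {e : α → β} (he : Measurable e) (κ : ProbabilityTheory.Kernel β α)
    [ProbabilityTheory.IsMarkovKernel κ] {π : Measure β}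
    (hfib : ∀ᵐ u ∂π, κ u (e ⁻¹' {u}) = 1) : (π.bind κ).map e = π := by
  ext B hB
  rw [Measure.map_apply he hB, Measure.bind_apply (he hB) κ.aemeasurable,
    ← lintegral_indicator_one hB]
  refine lintegral_congr_ae ?_
  filter_upwards [hfib] with u hu
  by_cases huB : u ∈ B
  · rw [Set.indicator_of_mem huB]
    refine le_antisymm prob_le_one (hu.symm.le.trans (measure_mono ?_))
    exact Set.preimage_mono (Set.singleton_subset_iff.mpr huB)
  · rw [Set.indicator_of_notMem huB, ← compl_compl (e ⁻¹' B),
      prob_compl_eq_zero_iff (he hB).compl]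
    refine le_antisymm prob_le_one (hu.symm.le.trans (measure_mono ?_))
    rintro x rfl
    exact huB

/-- from dynamic to static Schrödinger bridges.  If `P̂` minimizes
`KL(·‖R)` among path measures whose endpoint distribution lies in `Π(ρ0,ρT)` and
this infimum is finite, then `π̂ := e∗P̂` minimizes `KL(·‖e∗R)` over `Π(ρ0,ρT)`,
and the two infima are equal. -/
theorem dynamic_to_static_SBP {n : ℕ} {Ω : Type*} [MeasurableSpace Ω] [StandardBorelSpace Ω]
    (ρ0 ρT : Measure (Fin n → ℝ))
    [IsProbabilityMeasure ρ0] [IsProbabilityMeasure ρT]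
    (e : Ω → (Fin n → ℝ) × (Fin n → ℝ)) (he : Measurable e)
    (R : Measure Ω) [IsProbabilityMeasure R]
    (κ : ProbabilityTheory.Kernel ((Fin n → ℝ) × (Fin n → ℝ)) Ω)
    [ProbabilityTheory.IsMarkovKernel κ]
    -- κ disintegrates R over e
    (hdis : ∀ A : Set Ω, MeasurableSet A →
      ∀ B : Set ((Fin n → ℝ) × (Fin n → ℝ)), MeasurableSet B →
        R (A ∩ e ⁻¹' B) = ∫⁻ u in B, κ u A ∂(R.map e))
    (hbridge : ∀ᵐ u ∂(R.map e), κ u (e ⁻¹' {u}) = 1)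
    -- P̂ attains the infimum of KL(·‖R) over {P : e∗P ∈ Π(ρ0,ρT)}, finitely
    (Phat : Measure Ω) [IsProbabilityMeasure Phat]
    (hPmem : Phat.map e ∈ Coupling ρ0 ρT)
    (hPmin : ∀ P : Measure Ω, IsProbabilityMeasure P → P.map e ∈ Coupling ρ0 ρT →
      KL Phat R ≤ KL P R)
    (hPfin : KL Phat R ≠ ⊤) :
    (∀ π ∈ Coupling ρ0 ρT, KL (Phat.map e) (R.map e) ≤ KL π (R.map e)) ∧
    KL (Phat.map e) (R.map e) = KL Phat R := by
  have : IsProbabilityMeasure (R.map e) := Measure.isProbabilityMeasure_map he.aemeasurable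
  have hR : (R.map e).bind κ = R := by
    ext A hA
    rw [Measure.bind_apply hA κ.aemeasurable]
    simpa using (hdis A hA Set.univ MeasurableSet.univ).symm
  have lift_le : ∀ π ∈ Coupling ρ0 ρT, KL Phat R ≤ KL π (R.map e) := by
    intro π hπ
    have : IsProbabilityMeasure π := hπ.1
    by_cases hac : π ≪ R.map e
    · have hmap : (π.bind κ).map e = π := map_bind_eq_of_ae_fiber he κ (hac.ae_le hbridge)
      have hle := InformationTheory.klDiv_comp_right_le π (R.map e) κ
      rw [hR] at hle
      calc KL Phat R ≤ KL (π.bind κ) R := hPmin _ inferInstance (hmap.symm ▸ hπ)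
        _ ≤ KL π (R.map e) := by
          rw [KL_eq_coe_klDiv, KL_eq_coe_klDiv]
          exact_mod_cast hle
    · exact le_top.trans_eq (if_neg fun h => hac h.1).symm
  have : IsProbabilityMeasure (Phat.map e) := hPmem.1
  have map_le : KL (Phat.map e) (R.map e) ≤ KL Phat R := by
    rw [KL_eq_coe_klDiv, KL_eq_coe_klDiv]
    exact_mod_cast InformationTheory.klDiv_map_le Phat R he
  exact ⟨fun π hπ => map_le.trans (lift_le π hπ), le_antisymm map_le (lift_le _ hPmem)⟩
end

section
/- Finite-dimensional distributions of the h-transform: assume the Markov setting, let h be measurable, nonnegative, satisfying the mean-value property, with r0 := P(X_0 ∈ A0) > 0, and let P^h be the h-transform of P. Define the sub-Markov kernels P^h_{s,t}(x, dy) := (h(t,y)/h(s,x)) P_{s,t}(x, dy) if h(s,x) > 0, and P^h_{s,t}(x, ·) := 0 otherwise. Then for every N ≥ 1, all times 0 = t_0 < t_1 < ⋯ < t_N ≤ T and all Borel sets B_0, …, B_N ⊆ ℝ^n, P^h(X_{t_0} ∈ B_0, …, X_{t_N} ∈ B_N) = (1/r0) ∫_{B_0} ∫_{B_1} ⋯ ∫_{B_N}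 P^h_{t_{N−1}, t_N}(x_{N−1}, dx_N) ⋯ P^h_{0, t_1}(x_0, dx_1) ρ0(dx_0). In particular, under P^h the process X is Markov with transition kernels P^h_{s,t}. -/
open MeasureTheory Filter

/-- The nested integral `∫_{B_0} ∫_{B_1} ⋯ ∫_{B_N} Q_N(x_{N-1},dx_N) ⋯ Q_1(x_0,dx_1) μ0(dx_0)`,
encoded as a measure: `chain μ0 B Q N` applied to `univ` is exactly this iterated integral. -/
noncomputable def chain {E : Type*} [MeasurableSpace E]
    (μ0 : Measure E) (B : ℕ → Set E) (Q : ℕ → E → Measure E) : ℕ → Measure E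
  | 0 => μ0.restrict (B 0)
  | (k + 1) => ((chain μ0 B Q k).bind (Q (k + 1))).restrict (B (k + 1))

open ProbabilityTheory

open scoped ENNReal

section MarkovProperty

variable {Ω E : Type*} {m mΩ : MeasurableSpace Ω} [MeasurableSpace E]

/-- The Markov property on bounded functions, integrated over an event of the conditioning
σ-algebra. -/
lemma measure_inter_preimage_eq_setLIntegral_kernel {P : Measure Ω} [IsProbabilityMeasure P]
    (hm : m ≤ mΩ) {Y Y' : Ω → E} (hY : Measurable Y)
    (hY' : Measurable Y') (κ : Kernel E E) [IsMarkovKernel κ]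
    (hM : ∀ f : E → ℝ, Measurable f → (∃ C, ∀ x, |f x| ≤ C) →
      (fun ω => ∫ y, f y ∂(κ (Y ω))) =ᵐ[P] P[(fun ω => f (Y' ω)) | m])
    {A : Set Ω} (hA : MeasurableSet[m] A) {B : Set E} (hB : MeasurableSet B) :
    P (Y' ⁻¹' B ∩ A) = ∫⁻ ω in A, κ (Y ω) B ∂P := by
  have hind : Measurable (B.indicator (fun _ => (1 : ℝ))) := measurable_const.indicator hB
  have hbound : ∀ x, |B.indicator (fun _ => (1 : ℝ)) x| ≤ 1 := fun x => by
    by_cases hx : x ∈ B <;> simp [hx]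
  have hcond := hM _ hind ⟨1, hbound⟩
  have hint : Integrable (fun ω => B.indicator (fun _ => (1 : ℝ)) (Y' ω)) P :=
    Integrable.of_bound (hind.comp hY').aestronglyMeasurable 1
      (Eventually.of_forall fun ω => hbound (Y' ω))
  have hκ : Measurable fun ω => κ (Y ω) B := (κ.measurable_coe hB).comp hY
  have hreal : ∫ ω in A, (κ (Y ω)).real B ∂P = P.real (Y' ⁻¹' B ∩ A) := by
    calc ∫ ω in A, (κ (Y ω)).real B ∂P
        = ∫ ω in A, (∫ y, B.indicator (fun _ => (1 : ℝ)) y ∂(κ (Y ω))) ∂P := by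
          simp [integral_indicator hB]
      _ = ∫ ω in A, (P[(fun ω => B.indicator (fun _ => (1 : ℝ)) (Y' ω)) | m]) ω ∂P :=
          integral_congr_ae (ae_restrict_of_ae hcond)
      _ = ∫ ω in A, (Y' ⁻¹' B).indicator (fun _ => (1 : ℝ)) ω ∂P :=
          setIntegral_condExp hm hint hA
      _ = P.real (Y' ⁻¹' B ∩ A) := by
          rw [integral_indicator (hY' hB)]
          simp [measureReal_restrict_apply (hY' hB)]
  have hfin : ∫⁻ ω in A, κ (Y ω) B ∂P ≠ ∞ := by
    refine ((lintegral_mono fun ω => prob_le_one).trans_lt ?_).ne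
    simp
  simp only [Measure.real] at hreal
  rw [integral_toReal hκ.aemeasurable (Eventually.of_forall fun ω => measure_lt_top _ _)] at hreal
  exact ((ENNReal.toReal_eq_toReal_iff' hfin (measure_ne_top _ _)).1 hreal).symm

/-- The Markov property on bounded functions, tested against nonnegative functions `Z` measurable
for the conditioning σ-algebra. -/
lemma lintegral_mul_lintegral_kernel {P : Measure Ω} [IsProbabilityMeasure P]
    (hm : m ≤ mΩ) {Y Y' : Ω → E} (hY : Measurable Y)
    (hY' : Measurable Y') (κ : Kernel E E) [IsMarkovKernel κ]
    (hM : ∀ f : E → ℝ, Measurable f → (∃ C, ∀ x, |f x| ≤ C) →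
      (fun ω => ∫ y, f y ∂(κ (Y ω))) =ᵐ[P] P[(fun ω => f (Y' ω)) | m])
    {Z : Ω → ℝ≥0∞} (hZ : Measurable[m] Z) {φ : E → ℝ≥0∞} (hφ : Measurable φ) :
    ∫⁻ ω, Z ω * ∫⁻ y, φ y ∂(κ (Y ω)) ∂P = ∫⁻ ω, Z ω * φ (Y' ω) ∂P := by
  have hg : Measurable fun ω => ∫⁻ y, φ y ∂(κ (Y ω)) := hφ.lintegral_kernel.comp hY
  have hset : ∀ A, MeasurableSet[m] A →
      ∫⁻ ω in A, ∫⁻ y, φ y ∂(κ (Y ω)) ∂P = ∫⁻ ω in A, φ (Y' ω) ∂P := by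
    intro A hA
    have hlaw : ((P.restrict A).map Y).bind κ = (P.restrict A).map Y' := by
      ext B hB
      rw [Measure.bind_apply hB κ.aemeasurable, lintegral_map (κ.measurable_coe hB) hY,
        Measure.map_apply hY' hB, Measure.restrict_apply (hY' hB)]
      exact (measure_inter_preimage_eq_setLIntegral_kernel hm hY hY' κ hM hA hB).symm
    rw [← lintegral_map hφ hY', ← hlaw,
      Measure.lintegral_bind κ.aemeasurable hφ.aemeasurable,
      lintegral_map hφ.lintegral_kernel hY]
  have htrim : (P.withDensity fun ω => ∫⁻ y, φ y ∂(κ (Y ω))).trim hm =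
      (P.withDensity fun ω => φ (Y' ω)).trim hm := by
    refine @Measure.ext _ m _ _ fun A hA => ?_
    rw [trim_measurableSet_eq hm hA, trim_measurableSet_eq hm hA,
      withDensity_apply _ (hm _ hA), withDensity_apply _ (hm _ hA), hset A hA]
  have hZ' : Measurable Z := hZ.mono hm le_rfl
  have hφ' : Measurable fun ω => φ (Y' ω) := hφ.comp hY'
  have key := congrArg (fun μ : @Measure Ω m => @lintegral Ω m μ Z) htrim
  simp only [lintegral_trim hm hZ] at key
  rw [lintegral_withDensity_eq_lintegral_mul _ hg hZ',
    lintegral_withDensity_eq_lintegral_mul _ hφ' hZ'] at key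
  simpa only [Pi.mul_apply, mul_comm] using key

end MarkovProperty

section HTransformKernel

variable {E : Type*} [MeasurableSpace E]

/-- The sub-Markov kernel `x ↦ (v(y)/u(x)) κ(x, dy)`, set to zero where `u` vanishes. -/
noncomputable def hKernel (κ : Kernel E E) (u v : E → ℝ) (x : E) : Measure E :=
  if 0 < u x then (κ x).withDensity (fun y => ENNReal.ofReal (v y / u x)) else 0

lemma lintegral_hKernel_of_pos (κ : Kernel E E) {u v : E → ℝ} (hv : Measurable v) {x : E}
    (hx : 0 < u x) {f : E → ℝ≥0∞} (hf : Measurable f) :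
    ∫⁻ y, f y ∂(hKernel κ u v x) = ∫⁻ y, ENNReal.ofReal (v y / u x) * f y ∂(κ x) := by
  rw [hKernel, if_pos hx, lintegral_withDensity_eq_lintegral_mul _ (by fun_prop) hf]
  rfl

lemma measurable_hKernel (κ : Kernel E E) [IsSFiniteKernel κ] {u v : E → ℝ} (hu : Measurable u)
    (hv : Measurable v) : Measurable (hKernel κ u v) := by
  refine Measurable.ite (measurableSet_lt measurable_const hu) ?_ measurable_const
  refine Measure.measurable_of_measurable_coe _ fun s hs => ?_
  simp only [withDensity_apply _ hs]
  exact Measurable.setLIntegral_kernel_prod_right (by fun_prop) hs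

/-- Multiplying by `u` clears the denominator, including where `u` vanishes. -/
lemma ofReal_mul_lintegral_hKernel (κ : Kernel E E) {u v : E → ℝ} (hv : Measurable v) {x : E}
    (hux : ENNReal.ofReal (u x) = ∫⁻ y, ENNReal.ofReal (v y) ∂(κ x))
    {f : E → ℝ≥0∞} (hf : Measurable f) :
    ENNReal.ofReal (u x) * ∫⁻ y, f y ∂(hKernel κ u v x) =
      ∫⁻ y, ENNReal.ofReal (v y) * f y ∂(κ x) := by
  by_cases hx : 0 < u x
  · rw [lintegral_hKernel_of_pos κ hv hx hf, ← lintegral_const_mul _ (by fun_prop)]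
    refine lintegral_congr fun y => ?_
    rw [← mul_assoc, ← ENNReal.ofReal_mul hx.le, mul_div_cancel₀ _ hx.ne']
  · have h0 : ENNReal.ofReal (u x) = 0 := ENNReal.ofReal_of_nonpos (not_lt.1 hx)
    rw [h0, zero_mul]
    rw [h0, eq_comm, lintegral_eq_zero_iff (by fun_prop)] at hux
    symm
    rw [lintegral_eq_zero_iff (by fun_prop)]
    filter_upwards [hux] with y hy
    simp only [Pi.zero_apply] at hy ⊢
    rw [hy, zero_mul]

end HTransformKernel

/-- One step of the chain: propagating a weighted law through the `h`-kernel and the restriction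
to `B`, using the Markov property. -/
lemma lintegral_bind_hKernel_restrict {Ω E : Type*} {m mΩ : MeasurableSpace Ω} [MeasurableSpace E]
    {P : Measure Ω} [IsProbabilityMeasure P] (hm : m ≤ mΩ)
    {Y Y' : Ω → E} (hY : Measurable Y) (hY' : Measurable Y') (κ : Kernel E E) [IsMarkovKernel κ]
    (hM : ∀ f : E → ℝ, Measurable f → (∃ C, ∀ x, |f x| ≤ C) →
      (fun ω => ∫ y, f y ∂(κ (Y ω))) =ᵐ[P] P[(fun ω => f (Y' ω)) | m])
    {u v : E → ℝ} (hu : Measurable u) (hv : Measurable v)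
    (huv : ∀ x, ENNReal.ofReal (u x) = ∫⁻ y, ENNReal.ofReal (v y) ∂(κ x))
    {A : Set Ω} (hA : MeasurableSet[m] A) {c : Ω → ℝ≥0∞} (hc : Measurable[m] c) {ν : Measure E}
    (hν : ∀ f : E → ℝ≥0∞, Measurable f → (∀ x, ¬ 0 < u x → f x = 0) →
      ∫⁻ x, f x ∂ν = ∫⁻ ω in A, c ω * (ENNReal.ofReal (u (Y ω)) * f (Y ω)) ∂P)
    {B : Set E} (hB : MeasurableSet B) {f : E → ℝ≥0∞} (hf : Measurable f) :
    ∫⁻ y, f y ∂((ν.bind (hKernel κ u v)).restrict B) =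
      ∫⁻ ω in A ∩ Y' ⁻¹' B, c ω * (ENNReal.ofReal (v (Y' ω)) * f (Y' ω)) ∂P := by
  have hK := measurable_hKernel κ hu hv
  have hfB : Measurable (B.indicator f) := hf.indicator hB
  have hφ : Measurable fun y => ENNReal.ofReal (v y) * B.indicator f y := by fun_prop
  have hZ : Measurable[m] (A.indicator c) := hc.indicator hA
  rw [← lintegral_indicator hB, Measure.lintegral_bind hK.aemeasurable hfB.aemeasurable,
    hν (fun x => ∫⁻ y, B.indicator f y ∂(hKernel κ u v x))
      ((Measure.measurable_lintegral hfB).comp hK) fun x hx => by simp [hKernel, hx],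
    ← lintegral_indicator (hm _ hA), ← lintegral_indicator ((hm _ hA).inter (hY' hB))]
  simp only [ofReal_mul_lintegral_hKernel κ hv (huv _) hfB]
  calc ∫⁻ ω, A.indicator (fun ω => c ω * ∫⁻ y, ENNReal.ofReal (v y) * B.indicator f y ∂(κ (Y ω))) ω
          ∂P
      = ∫⁻ ω, A.indicator c ω * ∫⁻ y, ENNReal.ofReal (v y) * B.indicator f y ∂(κ (Y ω)) ∂P := by
        refine lintegral_congr fun ω => ?_
        by_cases hω : ω ∈ A <;> simp [hω]
    _ = ∫⁻ ω, A.indicator c ω * (ENNReal.ofReal (v (Y' ω)) * B.indicator f (Y' ω)) ∂P :=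
        lintegral_mul_lintegral_kernel hm hY hY' κ hM hZ hφ
    _ = _ := by
        refine lintegral_congr fun ω => ?_
        by_cases hω : ω ∈ A <;> by_cases hω' : Y' ω ∈ B <;> simp [hω, hω']

/-- finite-dimensional distributions of the h-transform.  With the
sub-Markov kernels `P^h_{s,t}(x,dy) = (h(t,y)/h(s,x))·P_{s,t}(x,dy)` (zero when
`h(s,x) = 0`), the `P^h`-probability of `X_{t_0} ∈ B_0, …, X_{t_N} ∈ B_N`
equals `(1/r0)` times the iterated integral of the kernels over `B_0,…,B_N`
against `ρ0`. -/
theorem hTransform_fdd {n : ℕ} {Ω : Type*} [mΩ : MeasurableSpace Ω]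
    (T : ℝ) (hT : 0 < T)
    (P : Measure Ω) [IsProbabilityMeasure P]
    (F : Filtration ℝ mΩ)
    (X : ℝ → Ω → (Fin n → ℝ))
    (hXadapted : ∀ t, 0 ≤ t → t ≤ T → Measurable[F t] (X t))
    (Pst : ℝ → ℝ → ProbabilityTheory.Kernel (Fin n → ℝ) (Fin n → ℝ))
    (hPstMarkov : ∀ s t, ProbabilityTheory.IsMarkovKernel (Pst s t))
    (hMarkov : ∀ s t, 0 ≤ s → s ≤ t → t ≤ T → ∀ f : (Fin n → ℝ) → ℝ,
      Measurable f → (∃ C, ∀ x, |f x| ≤ C) →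
      (fun ω => ∫ y, f y ∂(Pst s t (X s ω))) =ᵐ[P] P[(fun ω => f (X t ω)) | F s])
    (h : ℝ → (Fin n → ℝ) → ℝ)
    (hmeas : Measurable (fun p : ℝ × (Fin n → ℝ) => h p.1 p.2))
    (hnonneg : ∀ t x, 0 ≤ h t x)
    (hmv : ∀ s t x, 0 ≤ s → s ≤ t → t ≤ T →
      ENNReal.ofReal (h s x) = ∫⁻ y, ENNReal.ofReal (h t y) ∂(Pst s t x))
    (hr0 : 0 < P {ω | 0 < h 0 (X 0 ω)})
    -- the h-transform P^h of P
    (Ph : Measure Ω)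
    (hPh : Ph = P.withDensity (fun ω =>
      if 0 < h 0 (X 0 ω) then
        ENNReal.ofReal (h T (X T ω) / h 0 (X 0 ω)) / P {ω' | 0 < h 0 (X 0 ω')}
      else 0))
    -- times 0 = t_0 < t_1 < ⋯ < t_N ≤ T and Borel sets B_0, …, B_N
    (N : ℕ) (hN : 1 ≤ N)
    (t : ℕ → ℝ) (ht0 : t 0 = 0) (htmono : ∀ i, i < N → t i < t (i + 1)) (htT : t N ≤ T)
    (B : ℕ → Set (Fin n → ℝ)) (hB : ∀ i, MeasurableSet (B i))
    -- the sub-Markov transition kernels of the h-transform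
    (Qh : ℕ → (Fin n → ℝ) → Measure (Fin n → ℝ))
    (hQh : ∀ k x, Qh (k + 1) x =
      if 0 < h (t k) x then
        (Pst (t k) (t (k + 1)) x).withDensity
          (fun y => ENNReal.ofReal (h (t (k + 1)) y / h (t k) x))
      else 0) :
    Ph {ω | ∀ i, i ≤ N → X (t i) ω ∈ B i} =
      (chain (P.map (X 0)) B Qh N) Set.univ / P {ω' | 0 < h 0 (X 0 ω')} := by
  have hht : ∀ s, Measurable (h s) := fun s => hmeas.comp measurable_prodMk_left
  have htle : ∀ j, j ≤ N → ∀ i, i ≤ j → t i ≤ t j := by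
    intro j
    induction j with
    | zero => intro _ i hi; rw [Nat.le_zero.1 hi]
    | succ j ih =>
      intro hj i hi
      rcases Nat.le_succ_iff.1 hi with hi | rfl
      · exact (ih (by omega) i hi).trans (htmono j (by omega)).le
      · exact le_rfl
  have ht_nonneg : ∀ i, i ≤ N → 0 ≤ t i := fun i hi => ht0 ▸ htle i hi 0 (Nat.zero_le i)
  have ht_le : ∀ i, i ≤ N → t i ≤ T := fun i hi => (htle N le_rfl i hi).trans htT
  have hXm : ∀ s, 0 ≤ s → s ≤ T → Measurable (X s) := fun s h0 h1 =>
    (hXadapted s h0 h1).mono (F.le s) le_rfl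
  have hX0 : Measurable (X 0) := hXm 0 le_rfl hT.le
  set S : ℕ → Set Ω := fun k => {ω | ∀ i, i ≤ k → X (t i) ω ∈ B i} with hS
  have hS_succ : ∀ k, S (k + 1) = S k ∩ X (t (k + 1)) ⁻¹' B (k + 1) := by
    intro k
    ext ω
    simp only [hS, Set.mem_ofPred_eq, Set.mem_inter_iff, Set.mem_preimage]
    refine ⟨fun hω => ⟨fun i hi => hω i (by omega), hω _ le_rfl⟩, fun hω i hi => ?_⟩
    rcases Nat.le_succ_iff.1 hi with hi | rfl
    · exact hω.1 i hi
    · exact hω.2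
  have hSm : ∀ k, k ≤ N → MeasurableSet[F (t k)] (S k) := by
    intro k hk
    have : S k = ⋂ i, ⋂ (_ : i ≤ k), X (t i) ⁻¹' B i := by
      ext ω
      simp [hS]
    rw [this]
    refine MeasurableSet.iInter fun i => MeasurableSet.iInter fun hi => ?_
    exact F.mono (htle k hk i hi) _
      (hXadapted (t i) (ht_nonneg i (hi.trans hk)) (ht_le i (hi.trans hk)) (hB i))
  set c₀ : (Fin n → ℝ) → ℝ≥0∞ :=
    fun x => if 0 < h 0 x then (ENNReal.ofReal (h 0 x))⁻¹ else 0 with hc₀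
  have hc₀m : Measurable c₀ :=
    Measurable.ite (measurableSet_lt measurable_const (hht 0)) (hht 0).ennreal_ofReal.inv
      measurable_const
  set c : Ω → ℝ≥0∞ := fun ω => c₀ (X 0 ω) with hc
  have hcm : ∀ s, 0 ≤ s → Measurable[F s] c := fun s hs =>
    (hc₀m.comp (hXadapted 0 le_rfl hT.le)).mono (F.mono hs) le_rfl
  have hQ : ∀ k, Qh (k + 1) = hKernel (Pst (t k) (t (k + 1))) (h (t k)) (h (t (k + 1))) :=
    fun k => funext fun x => hQh k x
  have step : ∀ k, k < N →
      (∀ f : (Fin n → ℝ) → ℝ≥0∞, Measurable f → (∀ x, ¬ 0 < h (t k) x → f x = 0) →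
        ∫⁻ x, f x ∂(chain (P.map (X 0)) B Qh k) =
          ∫⁻ ω in S k, c ω * (ENNReal.ofReal (h (t k) (X (t k) ω)) * f (X (t k) ω)) ∂P) →
      ∀ f : (Fin n → ℝ) → ℝ≥0∞, Measurable f →
        ∫⁻ x, f x ∂(chain (P.map (X 0)) B Qh (k + 1)) =
          ∫⁻ ω in S (k + 1),
            c ω * (ENNReal.ofReal (h (t (k + 1)) (X (t (k + 1)) ω)) * f (X (t (k + 1)) ω)) ∂P := by
    intro k hk hν f hf
    have h0 := ht_nonneg k hk.le
    have h1 := (htmono k hk).le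
    have h2 := ht_le (k + 1) hk
    rw [chain, hQ, hS_succ]
    exact lintegral_bind_hKernel_restrict (F.le _) (hXm _ h0 (h1.trans h2))
      (hXm _ (h0.trans h1) h2) _ (hMarkov _ _ h0 h1 h2) (hht _) (hht _)
      (fun x => hmv _ _ x h0 h1 h2) (hSm k hk.le) (hcm _ h0) hν (hB _) hf
  have base : ∀ f : (Fin n → ℝ) → ℝ≥0∞, Measurable f → (∀ x, ¬ 0 < h (t 0) x → f x = 0) →
      ∫⁻ x, f x ∂(chain (P.map (X 0)) B Qh 0) =
        ∫⁻ ω in S 0, c ω * (ENNReal.ofReal (h (t 0) (X (t 0) ω)) * f (X (t 0) ω)) ∂P := by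
    intro f hf hf0
    rw [ht0] at hf0
    have hS0 : S 0 = X 0 ⁻¹' B 0 := by
      ext ω
      simp [hS, ht0]
    rw [chain, Measure.restrict_map hX0 (hB 0), lintegral_map hf hX0, hS0, ht0]
    refine lintegral_congr fun ω => ?_
    by_cases hω : 0 < h 0 (X 0 ω)
    · simp only [hc, hc₀, if_pos hω]
      rw [← mul_assoc, ENNReal.inv_mul_cancel (by simpa using hω) ENNReal.ofReal_ne_top, one_mul]
    · simp [hf0 _ hω]
  have main : ∀ k, k < N → ∀ f : (Fin n → ℝ) → ℝ≥0∞, Measurable f →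
      ∫⁻ x, f x ∂(chain (P.map (X 0)) B Qh (k + 1)) =
        ∫⁻ ω in S (k + 1),
          c ω * (ENNReal.ofReal (h (t (k + 1)) (X (t (k + 1)) ω)) * f (X (t (k + 1)) ω)) ∂P := by
    intro k
    induction k with
    | zero => exact fun hk => step 0 hk base
    | succ k ih => exact fun hk => step (k + 1) hk fun f hf _ => ih (by omega) f hf
  obtain ⟨M, rfl⟩ : ∃ M, N = M + 1 := ⟨N - 1, by omega⟩
  have h0 := ht_nonneg _ (le_refl (M + 1))
  have hSN : MeasurableSet (S (M + 1)) := F.le _ _ (hSm _ le_rfl)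
  have hcN : Measurable c := hc₀m.comp hX0
  have hXT : Measurable (X T) := hXm T hT.le le_rfl
  have hmarg : ∫⁻ ω in S (M + 1), c ω * ENNReal.ofReal (h (t (M + 1)) (X (t (M + 1)) ω)) ∂P =
      ∫⁻ ω in S (M + 1), c ω * ENNReal.ofReal (h T (X T ω)) ∂P := by
    have key := lintegral_mul_lintegral_kernel (F.le _) (hXm _ h0 htT) hXT (Pst (t (M + 1)) T)
      (hMarkov _ _ h0 htT le_rfl) ((hcm _ h0).indicator (hSm _ le_rfl)) (hht T).ennreal_ofReal
    simp only [← hmv _ _ _ h0 htT le_rfl] at key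
    rw [← lintegral_indicator hSN, ← lintegral_indicator hSN]
    simpa only [Set.indicator_mul_left] using key
  have huniv := main M (Nat.lt_succ_self M) (fun _ => 1) measurable_const
  simp only [lintegral_one, mul_one] at huniv
  rw [huniv, hmarg, hPh, withDensity_apply _ hSN, div_eq_mul_inv, ← lintegral_mul_const _
    (by fun_prop)]
  refine lintegral_congr fun ω => ?_
  by_cases hω : 0 < h 0 (X 0 ω)
  · simp only [hc, hc₀, if_pos hω]
    rw [ENNReal.ofReal_div_of_pos hω, div_eq_mul_inv, div_eq_mul_inv,
      mul_comm (ENNReal.ofReal (h 0 (X 0 ω)))⁻¹]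
  · simp [hc, hc₀, hω]
end

section
/- Product rule for the jump-diffusion operator: let L be the jump-diffusion operator with coefficients b, σ, γ, ν satisfying Assumptions (B). Let h : [0,T] × ℝ^n → [0,∞) and f : [0,T] × ℝ^n → ℝ be of class C^{1,2}. Then at every point (t,x) ∈ (0,T) × ℝ^n with h(t,x) > 0, all the integrals appearing in L(hf)(t,x), Lh(t,x), b^h(t,x) and in L̃f(t,x) converge absolutely, and L(hf)(t,x) = h(t,x)·L̃f(t,x) + f(t,x)·Lh(t,x), where L̃ is the operator of the same form as L with drift b replaced by b^h(t,x) and Lévy measure ν(dz) replaced by ν^h(t,x; dz). Equivalently, writing 𝓛 := ∂_t + L and 𝓛̃ := ∂_t + L̃, one has 𝓛(hf)(t,x) = h(t,x)·𝓛̃f(t,x) + f(t,x)·𝓛h(t,x); in particular, if h is harmonic (𝓛h = 0 on (0,T)×ℝ^n), then 𝓛(hf)/h = 𝓛̃f on {h > 0}. -/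
open MeasureTheory

/-- Partial derivative in the `i`-th coordinate direction. -/
noncomputable def pderiv' {n : ℕ} (f : (Fin n → ℝ) → ℝ) (i : Fin n) (x : Fin n → ℝ) : ℝ :=
  fderiv ℝ f x (Pi.single i 1)

/-- The jump-diffusion operator `L` with drift `b`, diffusion matrix `a = σσᵀ`,
jump coefficient `γ` and Lévy measure `ν`:
`Lf(t,x) = b·∇f + ½∑ aᵢⱼ ∂²f/∂xᵢ∂xⱼ + ∫ [f(t,x+γ) − f(t,x) − 1_{|z|≤1} γ·∇f] dν`. -/
noncomputable def Lop {n l : ℕ}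
    (b : ℝ → (Fin n → ℝ) → Fin n → ℝ)
    (a : ℝ → (Fin n → ℝ) → Fin n → Fin n → ℝ)
    (γ : ℝ → (Fin n → ℝ) → (Fin l → ℝ) → Fin n → ℝ)
    (ν : Measure (Fin l → ℝ))
    (f : ℝ → (Fin n → ℝ) → ℝ) (t : ℝ) (x : Fin n → ℝ) : ℝ :=
  (∑ i, b t x i * pderiv' (f t) i x)
  + (1 / 2) * ∑ i, ∑ j, a t x i j * pderiv' (fun y => pderiv' (f t) j y) i x
  + ∫ z, (f t (x + γ t x z) - f t x -
      (if ‖z‖ ≤ 1 then ∑ i, γ t x z i * pderiv' (f t) i x else 0)) ∂ν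

/-- A function `f : [0,T] × ℝⁿ → ℝ` is of class `C^{1,2}`: `f`, `∇f`, `∇²f` are
continuous on `[0,T] × ℝⁿ` (here: jointly continuous), `f(t,·)` is `C²` for each `t`,
and `∂ₜ f` exists on `(0,T) × ℝⁿ` and is continuous there. -/
def IsC12 {n : ℕ} (T : ℝ) (f : ℝ → (Fin n → ℝ) → ℝ) : Prop :=
  Continuous (fun p : ℝ × (Fin n → ℝ) => f p.1 p.2) ∧
  (∀ t, ContDiff ℝ 2 (f t)) ∧
  Continuous (fun p : ℝ × (Fin n → ℝ) => fderiv ℝ (f p.1) p.2) ∧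
  Continuous (fun p : ℝ × (Fin n → ℝ) => fderiv ℝ (fderiv ℝ (f p.1)) p.2) ∧
  (∀ x t, 0 < t → t < T → DifferentiableAt ℝ (fun s => f s x) t) ∧
  ContinuousOn (fun p : ℝ × (Fin n → ℝ) => deriv (fun s => f s p.2) p.1) (Set.Ioo 0 T ×ˢ Set.univ)

open scoped ENNReal

theorem ContDiff.exists_norm_taylor_one_le {E : Type*} [NormedAddCommGroup E] [NormedSpace ℝ E]
    [ProperSpace E] {g : E → ℝ} (hg : ContDiff ℝ 2 g) (x : E) (R : ℝ) :
    ∃ K, 0 ≤ K ∧ ∀ v, ‖v‖ ≤ R → |g (x + v) - g x - fderiv ℝ g x v| ≤ K * ‖v‖ ^ 2 := by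
  have hg' : ContDiff ℝ 1 (fderiv ℝ g) := hg.fderiv_right (by norm_num)
  obtain ⟨M, hM⟩ := (isCompact_closedBall x R).exists_bound_of_continuousOn
    (hg'.continuous_fderiv (by norm_num)).continuousOn
  refine ⟨max M 0, le_max_right _ _, fun v hv => ?_⟩
  have hx : x ∈ Metric.closedBall x ‖v‖ := Metric.mem_closedBall_self (norm_nonneg v)
  have hxv : x + v ∈ Metric.closedBall x ‖v‖ := by simp
  have hlip : ∀ y ∈ Metric.closedBall x ‖v‖,
      ‖fderiv ℝ g y - fderiv ℝ g x‖ ≤ max M 0 * ‖v‖ := by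
    intro y hy
    have h1 := (convex_closedBall x ‖v‖).norm_image_sub_le_of_norm_fderiv_le
      (fun z _ => hg'.differentiable (by norm_num) z)
      (fun z hz => (hM z (Metric.closedBall_subset_closedBall hv hz)).trans (le_max_left M 0))
      hx hy
    refine h1.trans (mul_le_mul_of_nonneg_left ?_ (le_max_right _ _))
    simpa [dist_eq_norm] using hy
  have h2 := (convex_closedBall x ‖v‖).norm_image_sub_le_of_norm_fderiv_le'
    (fun z _ => hg.differentiable (by norm_num) z) hlip hx hxv
  rw [add_sub_cancel_left, Real.norm_eq_abs] at h2
  exact h2.trans_eq (by ring)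

theorem ContDiff.exists_abs_sub_le {E : Type*} [NormedAddCommGroup E] [NormedSpace ℝ E]
    [ProperSpace E] {g : E → ℝ} (hg : ContDiff ℝ 2 g) (x : E) (R : ℝ) :
    ∃ K, 0 ≤ K ∧ ∀ v, ‖v‖ ≤ R → |g (x + v) - g x| ≤ K * ‖v‖ := by
  obtain ⟨K, hK0, hK⟩ := hg.exists_norm_taylor_one_le x R
  refine ⟨K * |R| + ‖fderiv ℝ g x‖, by positivity, fun v hv => ?_⟩
  calc |g (x + v) - g x|
      = |(g (x + v) - g x - fderiv ℝ g x v) + fderiv ℝ g x v| := by ring_nf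
    _ ≤ K * ‖v‖ ^ 2 + ‖fderiv ℝ g x‖ * ‖v‖ :=
        (abs_add_le _ _).trans (add_le_add (hK v hv) ((fderiv ℝ g x).le_opNorm v))
    _ ≤ (K * |R| + ‖fderiv ℝ g x‖) * ‖v‖ := by
        have : K * ‖v‖ * ‖v‖ ≤ K * ‖v‖ * |R| :=
          mul_le_mul_of_nonneg_left (hv.trans (le_abs_self R)) (by positivity)
        nlinarith

theorem sum_mul_pderiv' {n : ℕ} (g : (Fin n → ℝ) → ℝ) (x v : Fin n → ℝ) :
    ∑ i, v i * pderiv' g i x = fderiv ℝ g x v := by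
  conv_rhs => rw [pi_eq_sum_univ' v]
  simp [pderiv', map_sum]

theorem pderiv'_add {n : ℕ} {g k : (Fin n → ℝ) → ℝ} {x : Fin n → ℝ}
    (hg : DifferentiableAt ℝ g x) (hk : DifferentiableAt ℝ k x) (i : Fin n) :
    pderiv' (fun y => g y + k y) i x = pderiv' g i x + pderiv' k i x := by
  simp [pderiv', fderiv_fun_add hg hk]

theorem pderiv'_mul {n : ℕ} {g k : (Fin n → ℝ) → ℝ} {x : Fin n → ℝ}
    (hg : DifferentiableAt ℝ g x) (hk : DifferentiableAt ℝ k x) (i : Fin n) :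
    pderiv' (fun y => g y * k y) i x = g x * pderiv' k i x + k x * pderiv' g i x := by
  simp [pderiv', fderiv_fun_mul hg hk]

theorem ContDiff.differentiable_pderiv' {n : ℕ} {g : (Fin n → ℝ) → ℝ} (hg : ContDiff ℝ 2 g)
    (i : Fin n) : Differentiable ℝ (pderiv' g i) :=
  ((hg.fderiv_right (m := 1) (by norm_num)).differentiable (by norm_num)).clm_apply
    (differentiable_const _)

theorem pderiv'_pderiv'_mul {n : ℕ} {g k : (Fin n → ℝ) → ℝ} (hg : ContDiff ℝ 2 g)
    (hk : ContDiff ℝ 2 k) (x : Fin n → ℝ) (i j : Fin n) :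
    pderiv' (fun y => pderiv' (fun w => g w * k w) j y) i x =
      g x * pderiv' (fun y => pderiv' k j y) i x + k x * pderiv' (fun y => pderiv' g j y) i x
        + (pderiv' g i x * pderiv' k j x + pderiv' g j x * pderiv' k i x) := by
  have hg1 := hg.differentiable (by norm_num)
  have hk1 := hk.differentiable (by norm_num)
  have hgj := hg.differentiable_pderiv' j
  have hkj := hk.differentiable_pderiv' j
  have hfun : (fun y => pderiv' (fun w => g w * k w) j y) =
      fun y => g y * pderiv' k j y + k y * pderiv' g j y :=
    funext fun y => pderiv'_mul (hg1 y) (hk1 y) j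
  rw [hfun, pderiv'_add ((hg1 x).fun_mul (hkj x)) ((hk1 x).fun_mul (hgj x)),
    pderiv'_mul (hg1 x) (hkj x), pderiv'_mul (hk1 x) (hgj x)]
  ring

/-- A function dominated by `1 ∧ |z|²` is integrable against a Lévy measure. -/
theorem integrable_of_norm_le_min_one_sq {E F : Type*} [NormedAddCommGroup E] [MeasurableSpace E]
    [OpensMeasurableSpace E] [NormedAddCommGroup F] {ν : Measure E}
    (hν : ∫⁻ z, ENNReal.ofReal (min 1 (‖z‖ ^ 2)) ∂ν < ⊤) {φ : E → F}
    (hφ : AEStronglyMeasurable φ ν) (K : ℝ) (hK : ∀ z, ‖φ z‖ ≤ K * min 1 (‖z‖ ^ 2)) :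
    Integrable φ ν := by
  have hmin : Integrable (fun z : E => min 1 (‖z‖ ^ 2)) ν := by
    refine ⟨(measurable_const.min (measurable_norm.pow_const 2)).aestronglyMeasurable, ?_⟩
    rw [hasFiniteIntegral_iff_ofReal (Filter.Eventually.of_forall fun z => by positivity)]
    exact hν
  exact (hmin.const_mul K).mono' hφ (Filter.Eventually.of_forall hK)

theorem min_one_norm_sq {E : Type*} [NormedAddCommGroup E] (z : E) :
    (min 1 ‖z‖) ^ 2 = min 1 (‖z‖ ^ 2) := by
  rcases le_total ‖z‖ 1 with hz | hz
  · rw [min_eq_right hz, min_eq_right (pow_le_one₀ (norm_nonneg z) hz)]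
  · rw [min_eq_left hz, min_eq_left (one_le_pow₀ hz), one_pow]

section JumpPart

variable {n l : ℕ} {ν : Measure (Fin l → ℝ)} {γ : (Fin l → ℝ) → Fin n → ℝ} {C : ℝ}
  {g k : (Fin n → ℝ) → ℝ}

theorem measurable_compensated (hγ : Measurable γ) (hg : Continuous g) (x : Fin n → ℝ) :
    Measurable (fun z => g (x + γ z) - g x -
      (if ‖z‖ ≤ 1 then ∑ i, γ z i * pderiv' g i x else 0)) := by
  simp only [sum_mul_pderiv']
  exact ((hg.measurable.comp (hγ.const_add x)).sub_const _).sub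
    (Measurable.ite (measurableSet_le measurable_norm measurable_const)
      ((fderiv ℝ g x).continuous.measurable.comp hγ) measurable_const)

theorem exists_abs_compensated_le (hC : ∀ z, ‖γ z‖ ≤ C * min 1 ‖z‖) (hg : ContDiff ℝ 2 g)
    (x : Fin n → ℝ) :
    ∃ K, ∀ z, |g (x + γ z) - g x -
      (if ‖z‖ ≤ 1 then ∑ i, γ z i * pderiv' g i x else 0)| ≤ K * min 1 (‖z‖ ^ 2) := by
  have hR : ∀ z, ‖γ z‖ ≤ |C| * min 1 ‖z‖ := fun z =>
    (hC z).trans (mul_le_mul_of_nonneg_right (le_abs_self C) (by positivity))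
  have hR1 : ∀ z, ‖γ z‖ ≤ |C| := fun z =>
    (hR z).trans (mul_le_of_le_one_right (abs_nonneg C) (min_le_left _ _))
  obtain ⟨K, hK0, hK⟩ := hg.exists_norm_taylor_one_le x |C|
  obtain ⟨M, hM0, hM⟩ := hg.exists_abs_sub_le x |C|
  refine ⟨K * |C| ^ 2 + M * |C|, fun z => ?_⟩
  have hmin : 0 ≤ min 1 (‖z‖ ^ 2) := by positivity
  rw [sum_mul_pderiv']
  split_ifs with hz
  · calc _ ≤ K * ‖γ z‖ ^ 2 := hK _ (hR1 z)
      _ ≤ K * (|C| * min 1 ‖z‖) ^ 2 := by gcongr; exact hR z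
      _ = K * |C| ^ 2 * min 1 (‖z‖ ^ 2) := by rw [mul_pow, min_one_norm_sq]; ring
      _ ≤ _ := by gcongr; exact le_add_of_nonneg_right (by positivity)
  · have h1 : min 1 (‖z‖ ^ 2) = 1 := min_eq_left (one_le_pow₀ (not_le.mp hz).le)
    rw [sub_zero, h1, mul_one]
    calc _ ≤ M * ‖γ z‖ := hM _ (hR1 z)
      _ ≤ M * |C| := by gcongr; exact hR1 z
      _ ≤ _ := le_add_of_nonneg_left (by positivity)

theorem integrable_compensated (hν : ∫⁻ z, ENNReal.ofReal (min 1 (‖z‖ ^ 2)) ∂ν < ⊤)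
    (hγ : Measurable γ) (hC : ∀ z, ‖γ z‖ ≤ C * min 1 ‖z‖) (hg : ContDiff ℝ 2 g)
    (x : Fin n → ℝ) :
    Integrable (fun z => g (x + γ z) - g x -
      (if ‖z‖ ≤ 1 then ∑ i, γ z i * pderiv' g i x else 0)) ν := by
  obtain ⟨K, hK⟩ := exists_abs_compensated_le hC hg x
  exact integrable_of_norm_le_min_one_sq hν
    (measurable_compensated hγ hg.continuous x).aestronglyMeasurable K hK

theorem integrable_tilt_mul_compensated
    (hν : ∫⁻ z, ENNReal.ofReal (min 1 (‖z‖ ^ 2)) ∂ν < ⊤)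
    (hγ : Measurable γ) (hC : ∀ z, ‖γ z‖ ≤ C * min 1 ‖z‖) (hg : Continuous g)
    (hk : ContDiff ℝ 2 k) (x : Fin n → ℝ) :
    Integrable (fun z => g (x + γ z) / g x * (k (x + γ z) - k x -
      (if ‖z‖ ≤ 1 then ∑ i, γ z i * pderiv' k i x else 0))) ν := by
  obtain ⟨M, hM⟩ := (isCompact_closedBall x |C|).exists_bound_of_continuousOn
    (hg.div_const (g x)).continuousOn
  refine (integrable_compensated hν hγ hC hk x).bdd_mul (c := M)
    ((hg.measurable.comp (hγ.const_add x)).div_const _).aestronglyMeasurable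
    (Filter.Eventually.of_forall fun z => hM _ ?_)
  rw [Metric.mem_closedBall, dist_eq_norm, add_sub_cancel_left]
  exact (hC z).trans ((mul_le_mul_of_nonneg_right (le_abs_self C) (by positivity)).trans
    (mul_le_of_le_one_right (abs_nonneg C) (min_le_left _ _)))

theorem integrable_tilt_drift (hν : ∫⁻ z, ENNReal.ofReal (min 1 (‖z‖ ^ 2)) ∂ν < ⊤)
    (hγ : Measurable γ) (hC : ∀ z, ‖γ z‖ ≤ C * min 1 ‖z‖) (hg : ContDiff ℝ 2 g)
    (x : Fin n → ℝ) :
    Integrable (fun z => if ‖z‖ ≤ 1 then ((g (x + γ z) - g x) / g x) • γ z else 0) ν := by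
  have hR : ∀ z, ‖γ z‖ ≤ |C| * min 1 ‖z‖ := fun z =>
    (hC z).trans (mul_le_mul_of_nonneg_right (le_abs_self C) (by positivity))
  obtain ⟨M, hM0, hM⟩ := hg.exists_abs_sub_le x |C|
  refine integrable_of_norm_le_min_one_sq hν ?_ (M / |g x| * |C| ^ 2) fun z => ?_
  · exact (Measurable.ite (measurableSet_le measurable_norm measurable_const)
      ((((hg.continuous.measurable.comp (hγ.const_add x)).sub_const _).div_const _).smul hγ)
      measurable_const).aestronglyMeasurable
  · split_ifs
    · rw [norm_smul, norm_div, Real.norm_eq_abs, Real.norm_eq_abs]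
      calc _ ≤ M * ‖γ z‖ / |g x| * ‖γ z‖ := by
            gcongr
            exact hM _ ((hR z).trans
              (mul_le_of_le_one_right (abs_nonneg C) (min_le_left _ _)))
        _ = M / |g x| * ‖γ z‖ ^ 2 := by ring
        _ ≤ M / |g x| * (|C| * min 1 ‖z‖) ^ 2 := by gcongr; exact hR z
        _ = _ := by rw [mul_pow, min_one_norm_sq]; ring
    · rw [norm_zero]; positivity

theorem integral_compensated_mul (hν : ∫⁻ z, ENNReal.ofReal (min 1 (‖z‖ ^ 2)) ∂ν < ⊤)
    (hγ : Measurable γ) (hC : ∀ z, ‖γ z‖ ≤ C * min 1 ‖z‖) (hg : ContDiff ℝ 2 g)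
    (hk : ContDiff ℝ 2 k) (x : Fin n → ℝ) (hx : g x ≠ 0) :
    ∫ z, (g (x + γ z) * k (x + γ z) - g x * k x -
      (if ‖z‖ ≤ 1 then ∑ i, γ z i * pderiv' (fun y => g y * k y) i x else 0)) ∂ν =
    g x * (∫ z, g (x + γ z) / g x * (k (x + γ z) - k x -
        (if ‖z‖ ≤ 1 then ∑ i, γ z i * pderiv' k i x else 0)) ∂ν
      + ∑ i, (∫ z in {z : Fin l → ℝ | ‖z‖ ≤ 1},
          ((g (x + γ z) - g x) / g x) * γ z i ∂ν) * pderiv' k i x)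
    + k x * ∫ z, (g (x + γ z) - g x -
        (if ‖z‖ ≤ 1 then ∑ i, γ z i * pderiv' g i x else 0)) ∂ν := by
  have hS : MeasurableSet {z : Fin l → ℝ | ‖z‖ ≤ 1} :=
    measurableSet_le measurable_norm measurable_const
  have hI1 := integrable_tilt_mul_compensated hν hγ hC hg.continuous hk x
  have hI2 := integrable_compensated hν hγ hC hg x
  have hI3 : ∀ i, Integrable ({z : Fin l → ℝ | ‖z‖ ≤ 1}.indicator
      fun z => ((g (x + γ z) - g x) / g x) * γ z i) ν := by
    intro i
    have := (ContinuousLinearMap.proj (R := ℝ) (φ := fun _ : Fin n => ℝ) i).integrable_comp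
      (integrable_tilt_drift hν hγ hC hg x)
    refine this.congr (Filter.Eventually.of_forall fun z => ?_)
    by_cases hz : ‖z‖ ≤ 1 <;> simp [hz]
  have hI4 : Integrable (fun z => ∑ i, {z : Fin l → ℝ | ‖z‖ ≤ 1}.indicator
      (fun z => ((g (x + γ z) - g x) / g x) * γ z i) z * pderiv' k i x) ν :=
    integrable_finsetSum _ fun i _ => (hI3 i).mul_const _
  simp_rw [← integral_indicator hS, ← integral_mul_const]
  rw [← integral_finsetSum _ fun i _ => (hI3 i).mul_const _, ← integral_add hI1 hI4,
    ← integral_const_mul, ← integral_const_mul]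
  refine Eq.trans ?_ (integral_add ((hI1.add hI4).const_mul _) (hI2.const_mul _))
  refine integral_congr_ae (Filter.Eventually.of_forall fun z => ?_)
  have hmul : ∑ i, γ z i * pderiv' (fun y => g y * k y) i x =
      g x * ∑ i, γ z i * pderiv' k i x + k x * ∑ i, γ z i * pderiv' g i x := by
    rw [Finset.mul_sum, Finset.mul_sum, ← Finset.sum_add_distrib]
    refine Finset.sum_congr rfl fun i _ => ?_
    rw [pderiv'_mul (hg.differentiable (by norm_num) x) (hk.differentiable (by norm_num) x)]
    ring
  by_cases hz : ‖z‖ ≤ 1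
  · have hsum : ∑ i, (g (x + γ z) - g x) / g x * γ z i * pderiv' k i x =
        (g (x + γ z) - g x) / g x * ∑ i, γ z i * pderiv' k i x := by
      simp only [Finset.mul_sum, mul_assoc]
    simp only [hz, if_true, Set.indicator, Set.mem_ofPred_eq, hmul, hsum]
    field_simp
    ring
  · simp only [hz, if_false, Set.indicator, Set.mem_ofPred_eq, zero_mul, Finset.sum_const_zero]
    field_simp
    ring

end JumpPart

/-- Leibniz rule for a symmetric second-order part. -/
theorem sum_pderiv'_pderiv'_mul {n : ℕ} {g k : (Fin n → ℝ) → ℝ} (hg : ContDiff ℝ 2 g)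
    (hk : ContDiff ℝ 2 k) (x : Fin n → ℝ) {A : Fin n → Fin n → ℝ}
    (hA : ∀ i j, A i j = A j i) :
    ∑ i, ∑ j, A i j * pderiv' (fun y => pderiv' (fun w => g w * k w) j y) i x =
      g x * ∑ i, ∑ j, A i j * pderiv' (fun y => pderiv' k j y) i x
        + k x * ∑ i, ∑ j, A i j * pderiv' (fun y => pderiv' g j y) i x
        + 2 * ∑ i, (∑ j, A i j * pderiv' g j x) * pderiv' k i x := by
  have hswap : ∑ i, ∑ j, A i j * (pderiv' g i x * pderiv' k j x) =
      ∑ i, ∑ j, A i j * (pderiv' g j x * pderiv' k i x) := by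
    rw [Finset.sum_comm]
    exact Finset.sum_congr rfl fun i _ => Finset.sum_congr rfl fun j _ => by rw [hA]
  have hcross : ∑ i, (∑ j, A i j * pderiv' g j x) * pderiv' k i x =
      ∑ i, ∑ j, A i j * (pderiv' g j x * pderiv' k i x) := by
    simp only [Finset.sum_mul, mul_assoc]
  rw [hcross, two_mul]
  nth_rewrite 1 [← hswap]
  simp only [Finset.mul_sum, ← Finset.sum_add_distrib]
  refine Finset.sum_congr rfl fun i _ => Finset.sum_congr rfl fun j _ => ?_
  rw [pderiv'_pderiv'_mul hg hk]
  ring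

/-- product rule for the jump-diffusion operator.  Under
Assumptions (B), for `h, f` of class `C^{1,2}` and at any point
`(t,x) ∈ (0,T) × ℝⁿ` with `h(t,x) > 0`, all integrals converge absolutely and
`L(hf) = h·L̃f + f·Lh`, where `L̃` has drift `b^h` and Lévy measure `ν^h`;
equivalently `𝓛(hf) = h·𝓛̃f + f·𝓛h`, and if `𝓛h(t,x) = 0` then
`𝓛(hf)/h = 𝓛̃f` at `(t,x)`. -/
theorem product_rule_jump_diffusion {n m l : ℕ} (T : ℝ) (hT : 0 < T)
    (ν : Measure (Fin l → ℝ))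
    (hν0 : ν {0} = 0)
    (hνlevy : ∫⁻ z, ENNReal.ofReal (min 1 (‖z‖ ^ 2)) ∂ν < ⊤)
    (b : ℝ → (Fin n → ℝ) → Fin n → ℝ)
    (hbmeas : Measurable (fun p : ℝ × (Fin n → ℝ) => b p.1 p.2))
    (hbloc : ∀ R : ℝ, ∃ C, ∀ t x, |t| ≤ R → ‖x‖ ≤ R → ‖b t x‖ ≤ C)
    (σ : ℝ → (Fin n → ℝ) → Fin n → Fin m → ℝ)
    (hσmeas : Measurable (fun p : ℝ × (Fin n → ℝ) => σ p.1 p.2))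
    (hσloc : ∀ R : ℝ, ∃ C, ∀ t x, |t| ≤ R → ‖x‖ ≤ R → ∀ i j, |σ t x i j| ≤ C)
    (a : ℝ → (Fin n → ℝ) → Fin n → Fin n → ℝ)
    (ha : ∀ t x i j, a t x i j = ∑ k, σ t x i k * σ t x j k)
    (hannd : ∀ t x (v : Fin n → ℝ), 0 ≤ ∑ i, ∑ j, v i * a t x i j * v j)
    (γ : ℝ → (Fin n → ℝ) → (Fin l → ℝ) → Fin n → ℝ)
    (hγmeas : Measurable (fun p : ℝ × (Fin n → ℝ) × (Fin l → ℝ) => γ p.1 p.2.1 p.2.2))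
    (hγ0 : ∀ t x, γ t x 0 = 0)
    (hγloc : ∀ R : ℝ, ∃ C, ∀ t x z, |t| ≤ R → ‖x‖ ≤ R → ‖γ t x z‖ ≤ C * min 1 ‖z‖)
    -- h and f of class C^{1,2}, h nonnegative
    (h f : ℝ → (Fin n → ℝ) → ℝ)
    (hhC12 : IsC12 T h) (hfC12 : IsC12 T f)
    (hhnonneg : ∀ t x, 0 ≤ h t x)
    -- the point (t,x) ∈ (0,T) × ℝⁿ with h(t,x) > 0
    (t : ℝ) (x : Fin n → ℝ) (ht0 : 0 < t) (htT : t < T) (hhpos : 0 < h t x)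
    -- the transformed drift b^h (as a constant coefficient function, evaluated at (t,x))
    (bh : ℝ → (Fin n → ℝ) → Fin n → ℝ)
    (hbh : ∀ i, bh t x i = b t x i
      + (∑ j, a t x i j * (pderiv' (h t) j x / h t x))
      + ∫ z in {z : Fin l → ℝ | ‖z‖ ≤ 1},
          ((h t (x + γ t x z) - h t x) / h t x) * γ t x z i ∂ν)
    (hbhconst : ∀ s y, bh s y = bh t x)
    -- the transformed Lévy measure ν^h(t,x;·)
    (νh : Measure (Fin l → ℝ))
    (hνh : νh = ν.withDensity (fun z => ENNReal.ofReal (h t (x + γ t x z) / h t x))) :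
    -- absolute convergence of all the integrals involved
    Integrable (fun z => h t (x + γ t x z) * f t (x + γ t x z) - h t x * f t x -
      (if ‖z‖ ≤ 1 then ∑ i, γ t x z i * pderiv' (fun y => h t y * f t y) i x else 0)) ν ∧
    Integrable (fun z => h t (x + γ t x z) - h t x -
      (if ‖z‖ ≤ 1 then ∑ i, γ t x z i * pderiv' (h t) i x else 0)) ν ∧
    Integrable (fun z => if ‖z‖ ≤ 1 then
      ((h t (x + γ t x z) - h t x) / h t x) • γ t x z else 0) ν ∧
    Integrable (fun z => f t (x + γ t x z) - f t x -
      (if ‖z‖ ≤ 1 then ∑ i, γ t x z i * pderiv' (f t) i x else 0)) νh ∧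
    -- the product rule for L
    Lop b a γ ν (fun s y => h s y * f s y) t x =
      h t x * Lop bh a γ νh f t x + f t x * Lop b a γ ν h t x ∧
    -- the product rule for 𝓛 = ∂ₜ + L
    (deriv (fun s => h s x * f s x) t + Lop b a γ ν (fun s y => h s y * f s y) t x =
      h t x * (deriv (fun s => f s x) t + Lop bh a γ νh f t x)
      + f t x * (deriv (fun s => h s x) t + Lop b a γ ν h t x)) ∧
    -- if h is harmonic at (t,x), then 𝓛(hf)/h = 𝓛̃f there
    ((deriv (fun s => h s x) t + Lop b a γ ν h t x = 0) →
      (deriv (fun s => h s x * f s x) t + Lop b a γ ν (fun s y => h s y * f s y) t x) / h t x =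
        deriv (fun s => f s x) t + Lop bh a γ νh f t x) := by
  obtain ⟨C, hC'⟩ := hγloc (max |t| ‖x‖)
  have hC : ∀ z, ‖γ t x z‖ ≤ C * min 1 ‖z‖ :=
    fun z => hC' t x z (le_max_left _ _) (le_max_right _ _)
  have hγ : Measurable (γ t x) :=
    hγmeas.comp (measurable_const.prodMk (measurable_const.prodMk measurable_id))
  have hh : ContDiff ℝ 2 (h t) := hhC12.2.1 t
  have hf : ContDiff ℝ 2 (f t) := hfC12.2.1 t
  have hx : h t x ≠ 0 := hhpos.ne'
  have hdens : Measurable fun z => h t (x + γ t x z) / h t x :=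
    (hh.continuous.measurable.comp (hγ.const_add x)).div_const _
  have hdens0 : ∀ z, 0 ≤ h t (x + γ t x z) / h t x :=
    fun z => div_nonneg (hhnonneg _ _) hhpos.le
  have hdenstop : ∀ᵐ z ∂ν, ENNReal.ofReal (h t (x + γ t x z) / h t x) < ⊤ :=
    Filter.Eventually.of_forall fun z => ENNReal.ofReal_lt_top
  have hL : Lop b a γ ν (fun s y => h s y * f s y) t x =
      h t x * Lop bh a γ νh f t x + f t x * Lop b a γ ν h t x := by
    have hint := integral_compensated_mul hνlevy hγ hC hh hf x hx
    have hdiff := sum_pderiv'_pderiv'_mul hh hf x (A := a t x)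
      (fun i j => by simp only [ha, mul_comm])
    have hdrift : ∑ i, b t x i * pderiv' (fun y => h t y * f t y) i x =
        h t x * ∑ i, b t x i * pderiv' (f t) i x
          + f t x * ∑ i, b t x i * pderiv' (h t) i x := by
      rw [sum_mul_pderiv', sum_mul_pderiv', sum_mul_pderiv',
        fderiv_fun_mul (hh.differentiable (by norm_num) x) (hf.differentiable (by norm_num) x)]
      rfl
    have hbhsum : ∑ i, bh t x i * pderiv' (f t) i x =
        ∑ i, b t x i * pderiv' (f t) i x
        + (∑ i, (∑ j, a t x i j * pderiv' (h t) j x) * pderiv' (f t) i x) / h t x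
        + ∑ i, (∫ z in {z : Fin l → ℝ | ‖z‖ ≤ 1},
          ((h t (x + γ t x z) - h t x) / h t x) * γ t x z i ∂ν) * pderiv' (f t) i x := by
      rw [Finset.sum_div, ← Finset.sum_add_distrib, ← Finset.sum_add_distrib]
      refine Finset.sum_congr rfl fun i _ => ?_
      simp only [hbh i, ← mul_div_assoc, ← Finset.sum_div]
      ring
    have hνint : ∫ z, (f t (x + γ t x z) - f t x -
        (if ‖z‖ ≤ 1 then ∑ i, γ t x z i * pderiv' (f t) i x else 0)) ∂νh =
        ∫ z, h t (x + γ t x z) / h t x * (f t (x + γ t x z) - f t x -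
        (if ‖z‖ ≤ 1 then ∑ i, γ t x z i * pderiv' (f t) i x else 0)) ∂ν := by
      rw [hνh, integral_withDensity_eq_integral_toReal_smul hdens.ennreal_ofReal hdenstop]
      simp only [ENNReal.toReal_ofReal (hdens0 _), smul_eq_mul]
    simp only [Lop]
    rw [hint, hdiff, hdrift, hbhsum, hνint]
    field_simp
    ring
  have hderiv : deriv (fun s => h s x * f s x) t =
      h t x * deriv (fun s => f s x) t + f t x * deriv (fun s => h s x) t := by
    rw [deriv_fun_mul (hhC12.2.2.2.2.1 x t ht0 htT) (hfC12.2.2.2.2.1 x t ht0 htT)]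
    ring
  refine ⟨integrable_compensated (g := fun y => h t y * f t y) hνlevy hγ hC (hh.mul hf) x,
    integrable_compensated hνlevy hγ hC hh x, integrable_tilt_drift hνlevy hγ hC hh x,
    ?_, hL, ?_, fun hharm => ?_⟩
  · rw [hνh, integrable_withDensity_iff_integrable_smul' hdens.ennreal_ofReal hdenstop]
    simp only [ENNReal.toReal_ofReal (hdens0 _), smul_eq_mul]
    exact integrable_tilt_mul_compensated hνlevy hγ hC hh.continuous hf x
  · rw [hL, hderiv]
    ring
  · rw [hL, hderiv, div_eq_iff hx]
    linear_combination f t x * hharm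
end

section
/- Well-definedness of the h-transformed coefficients: let ν, b, σ, γ satisfy Assumptions (B) and let h : [0,T] × ℝ^n → [0,∞) be of class C^{1,2}. Then for every (t,x) ∈ [0,T] × ℝ^n with h(t,x) > 0: (i) ∫_{ℝ^ℓ} (1 ∧ |z|²) · [h(t, x+γ(t,x,z))/h(t,x)] ν(dz) < ∞, so that ν^h(t,x; ·) is a Lévy measure on ℝ^ℓ; and (ii) ∫_{|z|≤1} [|h(t, x+γ(t,x,z)) − h(t,x)|/h(t,x)] · |γ(t,x,z)| ν(dz) < ∞, so that the vector b^h(t,x) is well defined. -/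
open MeasureTheory

open scoped ENNReal

theorem lintegral_ofReal_lt_top_of_le_const_mul {α : Type*} [MeasurableSpace α] {μ : Measure α}
    {f g : α → ℝ} (A : ℝ) (hA : 0 ≤ A) (hg : ∫⁻ z, ENNReal.ofReal (g z) ∂μ < ⊤)
    (hfg : ∀ z, f z ≤ A * g z) : ∫⁻ z, ENNReal.ofReal (f z) ∂μ < ⊤ :=
  calc ∫⁻ z, ENNReal.ofReal (f z) ∂μ
      ≤ ∫⁻ z, ENNReal.ofReal A * ENNReal.ofReal (g z) ∂μ := by
        refine lintegral_mono fun z => ?_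
        rw [← ENNReal.ofReal_mul hA]
        exact ENNReal.ofReal_le_ofReal (hfg z)
    _ = ENNReal.ofReal A * ∫⁻ z, ENNReal.ofReal (g z) ∂μ :=
        lintegral_const_mul' _ _ ENNReal.ofReal_ne_top
    _ < ⊤ := ENNReal.mul_lt_top ENNReal.ofReal_lt_top hg

/-- A `C¹` function is bounded and Lipschitz with respect to the centre on each closed ball. -/
theorem ContDiff.exists_bound_and_lipschitz_closedBall {E : Type*} [NormedAddCommGroup E]
    [NormedSpace ℝ E] [ProperSpace E] {f : E → ℝ} (hf : ContDiff ℝ 1 f) (x : E) (r : ℝ) :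
    ∃ K, 0 ≤ K ∧ ∀ y, ‖y‖ ≤ r → |f (x + y)| ≤ K ∧ |f (x + y) - f x| ≤ K * ‖y‖ := by
  obtain ⟨K₀, hK₀⟩ := (isCompact_closedBall x r).exists_bound_of_continuousOn
    hf.continuous.continuousOn
  obtain ⟨K₁, hK₁⟩ := (isCompact_closedBall x r).exists_bound_of_continuousOn
    (hf.continuous_fderiv one_ne_zero).continuousOn
  refine ⟨max 0 (max K₀ K₁), le_max_left _ _, fun y hy => ?_⟩
  have hxy : x + y ∈ Metric.closedBall x r := by simpa using hy
  have hx : x ∈ Metric.closedBall x r := Metric.mem_closedBall_self ((norm_nonneg y).trans hy)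
  refine ⟨(hK₀ _ hxy).trans (by simp), ?_⟩
  have hLip := (convex_closedBall x r).norm_image_sub_le_of_norm_fderiv_le
    (fun z _ => hf.differentiable one_ne_zero z) hK₁ hx hxy
  rw [add_sub_cancel_left, Real.norm_eq_abs] at hLip
  exact hLip.trans (by gcongr; simp)

/-- well-definedness of the h-transformed coefficients.  Under
Assumptions (B), for `h ≥ 0` of class `C^{1,2}` and `(t,x) ∈ [0,T] × ℝⁿ` with
`h(t,x) > 0`: (i) `∫ (1 ∧ |z|²)·h(t,x+γ)/h(t,x) dν < ∞` (so `ν^h(t,x;·)` is a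
Lévy measure), and (ii) `∫_{|z|≤1} |h(t,x+γ)−h(t,x)|/h(t,x)·|γ| dν < ∞` (so
`b^h(t,x)` is well defined). -/
theorem hTransform_coefficients_wellDefined {n m l : ℕ} (T : ℝ) (hT : 0 < T)
    (ν : Measure (Fin l → ℝ))
    (hν0 : ν {0} = 0)
    (hνlevy : ∫⁻ z, ENNReal.ofReal (min 1 (‖z‖ ^ 2)) ∂ν < ⊤)
    (b : ℝ → (Fin n → ℝ) → Fin n → ℝ)
    (hbmeas : Measurable (fun p : ℝ × (Fin n → ℝ) => b p.1 p.2))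
    (hbloc : ∀ R : ℝ, ∃ C, ∀ t x, |t| ≤ R → ‖x‖ ≤ R → ‖b t x‖ ≤ C)
    (σ : ℝ → (Fin n → ℝ) → Fin n → Fin m → ℝ)
    (hσmeas : Measurable (fun p : ℝ × (Fin n → ℝ) => σ p.1 p.2))
    (hσloc : ∀ R : ℝ, ∃ C, ∀ t x, |t| ≤ R → ‖x‖ ≤ R → ∀ i j, |σ t x i j| ≤ C)
    (hannd : ∀ t x (v : Fin n → ℝ), 0 ≤ ∑ i, ∑ j, v i * (∑ k, σ t x i k * σ t x j k) * v j)
    (γ : ℝ → (Fin n → ℝ) → (Fin l → ℝ) → Fin n → ℝ)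
    (hγmeas : Measurable (fun p : ℝ × (Fin n → ℝ) × (Fin l → ℝ) => γ p.1 p.2.1 p.2.2))
    (hγ0 : ∀ t x, γ t x 0 = 0)
    (hγloc : ∀ R : ℝ, ∃ C, ∀ t x z, |t| ≤ R → ‖x‖ ≤ R → ‖γ t x z‖ ≤ C * min 1 ‖z‖)
    -- h of class C^{1,2}, nonnegative
    (h : ℝ → (Fin n → ℝ) → ℝ)
    (hhC12 : IsC12 T h)
    (hhnonneg : ∀ t x, 0 ≤ h t x)
    -- the point (t,x) ∈ [0,T] × ℝⁿ with h(t,x) > 0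
    (t : ℝ) (x : Fin n → ℝ) (ht0 : 0 ≤ t) (htT : t ≤ T) (hhpos : 0 < h t x) :
    -- (i) ν^h(t,x;·) is a Lévy measure
    (∫⁻ z, ENNReal.ofReal (min 1 (‖z‖ ^ 2)) *
        ENNReal.ofReal (h t (x + γ t x z) / h t x) ∂ν < ⊤) ∧
    (ν.withDensity (fun z => ENNReal.ofReal (h t (x + γ t x z) / h t x))) {0} = 0 ∧
    -- (ii) the integral defining b^h(t,x) converges absolutely
    (∫⁻ z in {z : Fin l → ℝ | ‖z‖ ≤ 1},
        ENNReal.ofReal (|h t (x + γ t x z) - h t x| / h t x * ‖γ t x z‖) ∂ν < ⊤) := by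
  obtain ⟨C₀, hC₀⟩ := hγloc (max |t| ‖x‖)
  obtain ⟨C, hC, hγC⟩ : ∃ C : ℝ, 0 ≤ C ∧ ∀ z, ‖γ t x z‖ ≤ C * min 1 ‖z‖ :=
    ⟨max 0 C₀, le_max_left _ _, fun z =>
      (hC₀ t x z (le_max_left _ _) (le_max_right _ _)).trans (by gcongr; exact le_max_right _ _)⟩
  have hγball : ∀ z, ‖γ t x z‖ ≤ C := fun z =>
    (hγC z).trans (mul_le_of_le_one_right hC (min_le_left _ _))
  have hγsq : ∀ z, ‖γ t x z‖ ^ 2 ≤ C ^ 2 * min 1 (‖z‖ ^ 2) := fun z => by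
    have hmin : min 1 ‖z‖ ^ 2 ≤ min 1 (‖z‖ ^ 2) :=
      le_min (pow_le_one₀ (by positivity) (min_le_left _ _)) (by gcongr; exact min_le_right _ _)
    calc ‖γ t x z‖ ^ 2 ≤ (C * min 1 ‖z‖) ^ 2 := by gcongr; exact hγC z
      _ = C ^ 2 * min 1 ‖z‖ ^ 2 := mul_pow _ _ _
      _ ≤ C ^ 2 * min 1 (‖z‖ ^ 2) := by gcongr
  obtain ⟨K, hK, hhK⟩ :=
    ((hhC12.2.1 t).of_le one_le_two).exists_bound_and_lipschitz_closedBall x C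
  refine ⟨?_, withDensity_absolutelyContinuous ν _ hν0, ?_⟩
  · simp_rw [← ENNReal.ofReal_mul (le_min zero_le_one (sq_nonneg ‖_‖))]
    refine lintegral_ofReal_lt_top_of_le_const_mul (K / h t x) (by positivity) hνlevy fun z => ?_
    rw [mul_comm]
    gcongr
    exact (le_abs_self _).trans (hhK _ (hγball z)).1
  · refine (setLIntegral_le_lintegral _ _).trans_lt <| lintegral_ofReal_lt_top_of_le_const_mul
      (K / h t x * C ^ 2) (by positivity) hνlevy fun z => ?_
    calc |h t (x + γ t x z) - h t x| / h t x * ‖γ t x z‖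
        ≤ K * ‖γ t x z‖ / h t x * ‖γ t x z‖ := by gcongr; exact (hhK _ (hγball z)).2
      _ = K / h t x * ‖γ t x z‖ ^ 2 := by ring
      _ ≤ K / h t x * (C ^ 2 * min 1 (‖z‖ ^ 2)) := by gcongr; exact hγsq z
      _ = K / h t x * C ^ 2 * min 1 (‖z‖ ^ 2) := by ring
end

section
/- Integrability of the adjoint jump integrand (one-dimensional case): let γ : ℝ⁺ × ℝ × ℝ → ℝ be bounded of class C^{1,∞,2} with all derivatives bounded and γ(t,x,0) = 0 for all (t,x); suppose that for every (t,z) the jump map φ_{t,z}(x) := x + γ(t,x,z) is a C^∞-diffeomorphism of ℝ and that λ(t,x,z) := φ_{t,z}^{-1}(x) − x is bounded of class C^{1,∞,2} with all derivatives bounded. Then: (i) (φ_{t,z}^{-1})'(x) > 0 for all (t,x,z); (ii) for every f ∈ C_c^∞(ℝ) and every compact K ⊆ ℝ⁺ × ℝ there is a constant C such that for all (t,x) ∈ K, |(φ_{t,z}^{-1})'(x)·f(φ_{t,z}^{-1}(x)) − f(x) + ∂_x[γ(t,·,z) f](x)| ≤ C z² whenever |z| ≤ 1, and |(φ_{t,z}^{-1})'(x)·f(φ_{t,z}^{-1}(x))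 − f(x)| ≤ C whenever |z| > 1; (iii) consequently, for every Lévy measure ν on ℝ (ν({0}) = 0, ∫ (1 ∧ z²) ν(dz) < ∞) and every (t,x), the function z ↦ (φ_{t,z}^{-1})'(x)·f(φ_{t,z}^{-1}(x)) − f(x) + 1_{{|z|≤1}}·∂_x[γ(t,·,z) f](x) is ν-integrable, so the jump part of the adjoint operator L* is well defined. -/
open MeasureTheory
open scoped ENNReal

open scoped ContDiff

section PartialDerivatives

variable {g : ℝ × ℝ × ℝ → ℝ}

lemma hasDerivAt_middle (hg : Differentiable ℝ g) (t x z : ℝ) :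
    HasDerivAt (fun y => g (t, y, z)) (fderiv ℝ g (t, x, z) (0, 1, 0)) x :=
  (hg (t, x, z)).hasFDerivAt.comp_hasDerivAt (f := fun y : ℝ => (t, y, z)) x
    ((hasDerivAt_const x t).prodMk ((hasDerivAt_id x).prodMk (hasDerivAt_const x z)))

lemma hasDerivAt_last (hg : Differentiable ℝ g) (t x z : ℝ) :
    HasDerivAt (fun w => g (t, x, w)) (fderiv ℝ g (t, x, z) (0, 0, 1)) z :=
  (hg (t, x, z)).hasFDerivAt.comp_hasDerivAt (f := fun w : ℝ => (t, x, w)) z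
    ((hasDerivAt_const z t).prodMk ((hasDerivAt_const z x).prodMk (hasDerivAt_id z)))

lemma continuous_deriv_middle (hg : ContDiff ℝ ∞ g) (t x : ℝ) :
    Continuous (fun z => deriv (fun y => g (t, y, z)) x) := by
  simp_rw [fun z => (hasDerivAt_middle (hg.differentiable (by simp)) t x z).deriv]
  have := hg.continuous_fderiv (by simp)
  fun_prop

/-- A function on the line vanishing to first order at `0` with second derivative bounded by `C`
on `[-1, 1]` is bounded by `C z²` there. -/
lemma abs_le_mul_sq_of_abs_deriv_two_le {g g' g'' : ℝ → ℝ} {C : ℝ}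
    (hg : ∀ z, HasDerivAt g (g' z) z) (hg' : ∀ z, HasDerivAt g' (g'' z) z)
    (h0 : g 0 = 0) (h0' : g' 0 = 0) (hC : ∀ z, |z| ≤ 1 → |g'' z| ≤ C) {z : ℝ} (hz : |z| ≤ 1) :
    |g z| ≤ C * z ^ 2 := by
  have hC0 : 0 ≤ C := (abs_nonneg _).trans (hC 0 (by simp))
  have hball : ∀ {r w : ℝ}, w ∈ Metric.closedBall (0 : ℝ) r ↔ |w| ≤ r := by simp
  have hfirst : ∀ w, |w| ≤ 1 → |g' w| ≤ C * |w| := fun w hw => by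
    simpa [h0'] using (convex_closedBall (0 : ℝ) 1).norm_image_sub_le_of_norm_hasDerivWithin_le
      (x := 0) (y := w) (fun v _ => (hg' v).hasDerivWithinAt) (fun v hv => hC v (hball.1 hv))
      (hball.2 (by simp)) (hball.2 hw)
  have := (convex_closedBall (0 : ℝ) |z|).norm_image_sub_le_of_norm_hasDerivWithin_le
    (C := C * |z|) (x := 0) (y := z) (fun v _ => (hg v).hasDerivWithinAt)
    (fun v hv => (hfirst v ((hball.1 hv).trans hz)).trans
      (mul_le_mul_of_nonneg_left (hball.1 hv) hC0))
    (hball.2 (by simp)) (hball.2 le_rfl)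
  simpa [h0, mul_assoc, ← pow_two] using this

/-- If `g` and `∂_z g` vanish on `{z = 0}`, then `∂_x g = O(z²)` locally uniformly. -/
lemma exists_abs_deriv_middle_le_mul_sq (hg : ContDiff ℝ ∞ g)
    (h0 : ∀ t x, g (t, x, 0) = 0) (h0' : ∀ t x, fderiv ℝ g (t, x, 0) (0, 0, 1) = 0)
    {K : Set (ℝ × ℝ)} (hK : IsCompact K) :
    ∃ C, ∀ t x z, (t, x) ∈ K → |z| ≤ 1 → |deriv (fun y => g (t, y, z)) x| ≤ C * z ^ 2 := by
  have hgd : Differentiable ℝ g := hg.differentiable (by simp)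
  have hG : ∀ v, ContDiff ℝ ∞ (fun q => fderiv ℝ g q v) := fun v =>
    (hg.fderiv_right (by simp)).clm_apply contDiff_const
  have hGd : ∀ v, Differentiable ℝ (fun q => fderiv ℝ g q v) := fun v =>
    (hG v).differentiable (by simp)
  have hGz : ContDiff ℝ ∞
      (fun q => fderiv ℝ (fun q => fderiv ℝ g q (0, 1, 0)) q (0, 0, 1)) :=
    ((hG (0, 1, 0)).fderiv_right (by simp)).clm_apply contDiff_const
  have hGzz := ((hGz.fderiv_right (m := ∞) (by simp)).clm_apply
    (contDiff_const (c := ((0, 0, 1) : ℝ × ℝ × ℝ)))).continuous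
  have hembed : Continuous (fun p : (ℝ × ℝ) × ℝ => (p.1.1, p.1.2, p.2)) := by fun_prop
  obtain ⟨C, hC⟩ := (hK.prod (isCompact_closedBall (0 : ℝ) 1)).exists_bound_of_continuousOn
    (hGzz.comp hembed).continuousOn
  refine ⟨C, fun t x z hmem hz => ?_⟩
  rw [(hasDerivAt_middle hgd t x z).deriv]
  refine abs_le_mul_sq_of_abs_deriv_two_le (g := fun w => fderiv ℝ g (t, x, w) (0, 1, 0))
    (fun w => hasDerivAt_last (hGd (0, 1, 0)) t x w)
    (fun w => hasDerivAt_last (hGz.differentiable (by simp)) t x w) ?_ ?_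
    (fun w hw => hC ((t, x), w) ⟨hmem, by simpa using hw⟩) hz
  · refine (hasDerivAt_middle hgd t x 0).unique ?_
    simpa [h0] using hasDerivAt_const x (0 : ℝ)
  · have hd : DifferentiableAt ℝ (fderiv ℝ g) (t, x, 0) :=
      (hg.fderiv_right (m := ∞) (by simp)).differentiable (by simp) _
    have happly : ∀ v w, fderiv ℝ (fun q => fderiv ℝ g q v) (t, x, 0) w =
        fderiv ℝ (fderiv ℝ g) (t, x, 0) w v := fun v w => by
      rw [fderiv_clm_apply hd (by fun_prop)]
      simp
    have hsymm : IsSymmSndFDerivAt ℝ g (t, x, 0) := hg.contDiffAt.isSymmSndFDerivAt (by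
      rw [minSmoothness_of_isRCLikeNormedField]
      exact WithTop.coe_le_coe.2 le_top)
    rw [happly, hsymm.eq, ← happly]
    refine (hasDerivAt_middle (hGd (0, 0, 1)) t x 0).unique ?_
    simpa [h0'] using hasDerivAt_const x (0 : ℝ)

end PartialDerivatives

lemma exists_contDiff_primitive {f : ℝ → ℝ} (hf : ContDiff ℝ ∞ f) :
    ∃ F : ℝ → ℝ, ContDiff ℝ ∞ F ∧ ∀ x, HasDerivAt F (f x) x := by
  have hF : ∀ x, HasDerivAt (fun x => ∫ y in (0 : ℝ)..x, f y) (f x) x := fun x =>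
    hf.continuous.integral_hasStrictDerivAt 0 x |>.hasDerivAt
  refine ⟨_, contDiff_infty_iff_deriv.2 ⟨fun x => (hF x).differentiableAt, ?_⟩, hF⟩
  rwa [funext fun x => (hF x).deriv]

lemma integrable_of_abs_le_mul_min_one_sq {ν : Measure ℝ}
    (hν : (∫⁻ z, ENNReal.ofReal (min 1 (z ^ 2)) ∂ν) < ⊤) {h : ℝ → ℝ} (hh : Measurable h)
    {C : ℝ} (hC : ∀ z, |h z| ≤ C * min 1 (z ^ 2)) : Integrable h ν := by
  have hmin : Integrable (fun z : ℝ => min 1 (z ^ 2)) ν :=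
    ⟨by fun_prop, (hasFiniteIntegral_iff_ofReal (.of_forall fun z => by positivity)).2 hν⟩
  exact (hmin.const_mul C).mono' hh.aestronglyMeasurable (.of_forall hC)

section Jump

variable {γ lam : ℝ → ℝ → ℝ → ℝ}

lemma jump_inverse_zero (hγ0 : ∀ t x, γ t x 0 = 0)
    (hinv : ∀ t z x, (x + lam t x z) + γ t (x + lam t x z) z = x) (t x : ℝ) :
    lam t x 0 = 0 := by
  have := hinv t 0 x
  rw [hγ0] at this
  linarith

lemma deriv_jump_inverse_pos
    (hγ : Differentiable ℝ (fun q : ℝ × ℝ × ℝ => γ q.1 q.2.1 q.2.2))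
    (hγ0 : ∀ t x, γ t x 0 = 0)
    (hlam : ContDiff ℝ ∞ (fun q : ℝ × ℝ × ℝ => lam q.1 q.2.1 q.2.2))
    (hinv : ∀ t z x, (x + lam t x z) + γ t (x + lam t x z) z = x) (t x z : ℝ) :
    0 < deriv (fun y => y + lam t y z) x := by
  have hψ : ContDiff ℝ ∞ (fun q : ℝ × ℝ × ℝ => q.2.1 + lam q.1 q.2.1 q.2.2) := by fun_prop
  have hcont := continuous_deriv_middle hψ t x
  by_contra! hneg
  obtain ⟨w, hw⟩ := mem_range_of_exists_le_of_exists_ge hcont (c := 0) ⟨z, hneg⟩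
    ⟨0, by simp [jump_inverse_zero hγ0 hinv]⟩
  have hψx := (hasDerivAt_middle (hψ.differentiable (by simp)) t x w).differentiableAt.hasDerivAt
  replace hψx := hψx.congr_deriv hw
  have hφ : HasDerivAt (fun y => y + γ t y w) _ (x + lam t x w) :=
    (hasDerivAt_id _).add (hasDerivAt_middle hγ t (x + lam t x w) w)
  have hcomp := hφ.comp (h := fun y => y + lam t y w) x hψx
  simp only [mul_zero] at hcomp
  refine zero_ne_one (hcomp.unique ((hasDerivAt_id x).congr_of_eventuallyEq ?_))
  exact .of_forall fun y => hinv t w y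

lemma fderiv_jump_inverse_last
    (hγ : Differentiable ℝ (fun q : ℝ × ℝ × ℝ => γ q.1 q.2.1 q.2.2))
    (hγ0 : ∀ t x, γ t x 0 = 0)
    (hlam : Differentiable ℝ (fun q : ℝ × ℝ × ℝ => lam q.1 q.2.1 q.2.2))
    (hinv : ∀ t z x, (x + lam t x z) + γ t (x + lam t x z) z = x) (t x : ℝ) :
    fderiv ℝ (fun q : ℝ × ℝ × ℝ => lam q.1 q.2.1 q.2.2) (t, x, 0) (0, 0, 1) =
      -fderiv ℝ (fun q : ℝ × ℝ × ℝ => γ q.1 q.2.1 q.2.2) (t, x, 0) (0, 0, 1) := by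
  have hl := hasDerivAt_last hlam t x 0
  set a := fderiv ℝ (fun q : ℝ × ℝ × ℝ => lam q.1 q.2.1 q.2.2) (t, x, 0) (0, 0, 1)
  have hlam0 := jump_inverse_zero hγ0 hinv t x
  have hcurve : HasDerivAt (fun z => (t, x + lam t x z, z)) ((0, a, 1) : ℝ × ℝ × ℝ) 0 :=
    (hasDerivAt_const _ t).prodMk ((hl.const_add x).prodMk (hasDerivAt_id _))
  have hγ' := (hγ (t, x, 0)).hasFDerivAt
  set L := fderiv ℝ (fun q : ℝ × ℝ × ℝ => γ q.1 q.2.1 q.2.2) (t, x, 0) with hL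
  have hcomp : HasDerivAt (fun z => γ t (x + lam t x z) z) (L (0, a, 1)) 0 :=
    HasFDerivAt.comp_hasDerivAt_of_eq (f := fun z => (t, x + lam t x z, z)) 0 hγ' hcurve
      (by simp [hlam0])
  have hLx : L (0, 1, 0) = 0 := by
    refine (hasDerivAt_middle hγ t x 0).unique ?_
    simpa [hγ0] using hasDerivAt_const x (0 : ℝ)
  have hLa : L (0, a, 1) = L (0, 0, 1) := by
    have : ((0, a, 1) : ℝ × ℝ × ℝ) = a • (0, 1, 0) + (0, 0, 1) := by simp
    rw [this, map_add, map_smul, hLx, smul_zero, zero_add]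
  have hsum := ((hl.const_add x).add hcomp).unique
    ((hasDerivAt_const (0 : ℝ) x).congr_of_eventuallyEq (.of_forall fun z => hinv t z x))
  linarith

lemma exists_abs_adjoint_small_jump_le_mul_sq
    (hγ : ContDiff ℝ ∞ (fun q : ℝ × ℝ × ℝ => γ q.1 q.2.1 q.2.2))
    (hγ0 : ∀ t x, γ t x 0 = 0)
    (hlam : ContDiff ℝ ∞ (fun q : ℝ × ℝ × ℝ => lam q.1 q.2.1 q.2.2))
    (hinv : ∀ t z x, (x + lam t x z) + γ t (x + lam t x z) z = x)
    {f : ℝ → ℝ} (hf : ContDiff ℝ ∞ f) {K : Set (ℝ × ℝ)} (hK : IsCompact K) :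
    ∃ C, ∀ t x z, (t, x) ∈ K → |z| ≤ 1 →
      |deriv (fun y => y + lam t y z) x * f (x + lam t x z) - f x +
        deriv (fun y => γ t y z * f y) x| ≤ C * z ^ 2 := by
  obtain ⟨F, hFsmooth, hF⟩ := exists_contDiff_primitive hf
  have hγd := hγ.differentiable (by simp)
  have hlamd := hlam.differentiable (by simp)
  have hlam0 := jump_inverse_zero hγ0 hinv
  -- The integrand is the `x`-derivative of `H`.
  let H : ℝ × ℝ × ℝ → ℝ := fun q =>
    F (q.2.1 + lam q.1 q.2.1 q.2.2) - F q.2.1 + γ q.1 q.2.1 q.2.2 * f q.2.1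
  have hψ : ContDiff ℝ ∞ (fun q : ℝ × ℝ × ℝ => q.2.1 + lam q.1 q.2.1 q.2.2) := by fun_prop
  have hγf : ContDiff ℝ ∞ (fun q : ℝ × ℝ × ℝ => γ q.1 q.2.1 q.2.2 * f q.2.1) := by fun_prop
  have hH : ContDiff ℝ ∞ H := by fun_prop
  obtain ⟨C, hC⟩ := exists_abs_deriv_middle_le_mul_sq hH (fun t x => by simp [H, hlam0, hγ0])
    (fun t x => by
      have hl := hasDerivAt_last hlamd t x 0
      have hg := hasDerivAt_last hγd t x 0
      rw [fderiv_jump_inverse_last hγd hγ0 hlamd hinv] at hl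
      have hFl := HasDerivAt.comp_of_eq (h := fun z => x + lam t x z) 0 (hF x) (hl.const_add x)
        (by simp [hlam0])
      refine (hasDerivAt_last (hH.differentiable (by simp)) t x 0).unique ?_
      exact ((hFl.sub_const (F x)).add (hg.mul_const (f x))).congr_deriv (by ring)) hK
  refine ⟨C, fun t x z hmem hz => ?_⟩
  convert hC t x z hmem hz using 2
  have hψx :=
    (hasDerivAt_middle (hψ.differentiable (by simp)) t x z).differentiableAt.hasDerivAt
  have hγfx :=
    (hasDerivAt_middle (hγf.differentiable (by simp)) t x z).differentiableAt.hasDerivAt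
  have hFψ := HasDerivAt.comp (h := fun y => y + lam t y z) x (hF (x + lam t x z)) hψx
  have := ((hFψ.sub (hF x)).add hγfx).deriv
  rw [mul_comm (f _)] at this
  exact this.symm

lemma exists_abs_adjoint_large_jump_le
    (hlam : Differentiable ℝ (fun q : ℝ × ℝ × ℝ => lam q.1 q.2.1 q.2.2))
    (hlambdd : ∃ C, ∀ q : ℝ × ℝ × ℝ,
      ‖fderiv ℝ (fun q : ℝ × ℝ × ℝ => lam q.1 q.2.1 q.2.2) q‖ ≤ C)
    {f : ℝ → ℝ} (hf : Continuous f) (hfc : HasCompactSupport f) :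
    ∃ C, ∀ t x z,
      |deriv (fun y => y + lam t y z) x * f (x + lam t x z) - f x| ≤ C := by
  obtain ⟨A, hA⟩ := hlambdd
  obtain ⟨M, hM⟩ := hfc.exists_bound_of_continuous hf
  refine ⟨(1 + A) * M + M, fun t x z => ?_⟩
  have hderiv := ((hasDerivAt_id x).add (hasDerivAt_middle hlam t x z)).deriv
  have hlx : |fderiv ℝ (fun q : ℝ × ℝ × ℝ => lam q.1 q.2.1 q.2.2) (t, x, z) (0, 1, 0)| ≤ A := by
    simpa using (ContinuousLinearMap.le_opNorm _ ((0, 1, 0) : ℝ × ℝ × ℝ)).trans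
      (mul_le_mul_of_nonneg_right (hA (t, x, z)) (norm_nonneg _))
  have hψx : |deriv (fun y => y + lam t y z) x| ≤ 1 + A := by
    refine (congrArg abs hderiv).trans_le ((abs_add_le _ _).trans ?_)
    simpa using hlx
  refine (abs_sub _ _).trans (add_le_add ?_ (hM x))
  rw [abs_mul]
  exact mul_le_mul hψx (hM _) (abs_nonneg _) ((abs_nonneg _).trans hψx)

end Jump

/-- integrability of the adjoint jump integrand (one-dimensional
case).  For a bounded smooth jump coefficient `γ` with `γ(t,x,0) = 0` whose jump
maps `φ_{t,z}(x) = x + γ(t,x,z)` are diffeomorphisms with inverse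
`φ_{t,z}^{-1}(x) = x + λ(t,x,z)`: (i) `(φ_{t,z}^{-1})' > 0`; (ii) for every
`f ∈ C_c^∞` and compact `K ⊆ ℝ⁺×ℝ` the adjoint integrand is `O(z²)` for
`|z| ≤ 1` and bounded for `|z| > 1`, uniformly on `K`; (iii) hence the adjoint
integrand is `ν`-integrable for every Lévy measure `ν`. -/
theorem adjoint_jump_integrand_integrable
    (γ lam : ℝ → ℝ → ℝ → ℝ)
    -- γ is bounded, of class C^{1,∞,2}, with all derivatives bounded
    (hγreg : ContDiff ℝ (⊤ : ℕ∞) (fun q : ℝ × ℝ × ℝ => γ q.1 q.2.1 q.2.2))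
    (hγbdd : ∀ k : ℕ, ∃ C, ∀ q : ℝ × ℝ × ℝ,
      ‖iteratedFDeriv ℝ k (fun q : ℝ × ℝ × ℝ => γ q.1 q.2.1 q.2.2) q‖ ≤ C)
    (hγ0 : ∀ t x, γ t x 0 = 0)
    -- λ = φ^{-1} − id is bounded, of class C^{1,∞,2}, with all derivatives bounded
    (hlamreg : ContDiff ℝ (⊤ : ℕ∞) (fun q : ℝ × ℝ × ℝ => lam q.1 q.2.1 q.2.2))
    (hlambdd : ∀ k : ℕ, ∃ C, ∀ q : ℝ × ℝ × ℝ,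
      ‖iteratedFDeriv ℝ k (fun q : ℝ × ℝ × ℝ => lam q.1 q.2.1 q.2.2) q‖ ≤ C)
    -- φ_{t,z} is a diffeomorphism with inverse x ↦ x + λ(t,x,z)
    (hinv1 : ∀ t z x, (x + lam t x z) + γ t (x + lam t x z) z = x)
    (hinv2 : ∀ t z x, (x + γ t x z) + lam t (x + γ t x z) z = x) :
    -- (i) positivity of the derivative of the inverse jump map
    (∀ t x z, 0 < deriv (fun y => y + lam t y z) x) ∧
    -- (ii) uniform bounds on compacts
    (∀ f : ℝ → ℝ, ContDiff ℝ (⊤ : ℕ∞) f → HasCompactSupport f →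
      ∀ K : Set (ℝ × ℝ), IsCompact K → K ⊆ {q | 0 ≤ q.1} →
      ∃ C : ℝ, ∀ t x z, (t, x) ∈ K →
        (|z| ≤ 1 →
          |deriv (fun y => y + lam t y z) x * f (x + lam t x z) - f x +
            deriv (fun y => γ t y z * f y) x| ≤ C * z ^ 2) ∧
        (1 < |z| →
          |deriv (fun y => y + lam t y z) x * f (x + lam t x z) - f x| ≤ C)) ∧
    -- (iii) ν-integrability of the adjoint jump integrand
    (∀ ν : Measure ℝ, ν {0} = 0 →
      (∫⁻ z, ENNReal.ofReal (min 1 (z ^ 2)) ∂ν) < ⊤ →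
      ∀ f : ℝ → ℝ, ContDiff ℝ (⊤ : ℕ∞) f → HasCompactSupport f →
      ∀ t x : ℝ, 0 ≤ t →
        Integrable (fun z =>
          deriv (fun y => y + lam t y z) x * f (x + lam t x z) - f x +
            (if |z| ≤ 1 then deriv (fun y => γ t y z * f y) x else 0)) ν) := by
  have hγd := hγreg.differentiable (by simp)
  have hlamd := hlamreg.differentiable (by simp)
  have hbound : ∀ f : ℝ → ℝ, ContDiff ℝ (⊤ : ℕ∞) f → HasCompactSupport f →
      ∀ K : Set (ℝ × ℝ), IsCompact K →
      ∃ C : ℝ, ∀ t x z, (t, x) ∈ K →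
        (|z| ≤ 1 →
          |deriv (fun y => y + lam t y z) x * f (x + lam t x z) - f x +
            deriv (fun y => γ t y z * f y) x| ≤ C * z ^ 2) ∧
        (1 < |z| →
          |deriv (fun y => y + lam t y z) x * f (x + lam t x z) - f x| ≤ C) := by
    intro f hf hfc K hK
    obtain ⟨A, hA⟩ := exists_abs_adjoint_small_jump_le_mul_sq hγreg hγ0 hlamreg hinv1 hf hK
    obtain ⟨B, hB⟩ := exists_abs_adjoint_large_jump_le hlamd
      (by simpa only [norm_iteratedFDeriv_one] using hlambdd 1) hf.continuous hfc
    exact ⟨max A B, fun t x z hmem =>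
      ⟨fun hz => (hA t x z hmem hz).trans
        (mul_le_mul_of_nonneg_right (le_max_left A B) (sq_nonneg z)),
      fun _ => (hB t x z).trans (le_max_right A B)⟩⟩
  refine ⟨deriv_jump_inverse_pos hγd hγ0 hlamreg hinv1,
    fun f hf hfc K hK _ => hbound f hf hfc K hK, ?_⟩
  intro ν _ hν f hf hfc t x _
  obtain ⟨C, hC⟩ := hbound f hf hfc {(t, x)} isCompact_singleton
  have hψ : ContDiff ℝ ∞ (fun q : ℝ × ℝ × ℝ => q.2.1 + lam q.1 q.2.1 q.2.2) := by fun_prop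
  have hγf : ContDiff ℝ ∞ (fun q : ℝ × ℝ × ℝ => γ q.1 q.2.1 q.2.2 * f q.2.1) := by fun_prop
  have hlamz : Continuous (fun z => lam t x z) :=
    hlamreg.continuous.comp (by fun_prop : Continuous fun z : ℝ => (t, x, z))
  have hfz : Continuous (fun z => f (x + lam t x z)) :=
    hf.continuous.comp (continuous_const.add hlamz)
  refine integrable_of_abs_le_mul_min_one_sq hν (C := C) ?_ fun z => ?_
  · exact ((((continuous_deriv_middle hψ t x).mul hfz).sub continuous_const).measurable).add
      (Measurable.ite (measurableSet_le measurable_id.abs measurable_const)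
        (continuous_deriv_middle hγf t x).measurable measurable_const)
  · obtain ⟨hsmall, hlarge⟩ := hC t x z rfl
    split_ifs with hz
    · rw [min_eq_right ((sq_le_one_iff_abs_le_one z).2 hz)]
      exact hsmall hz
    · have hz' : 1 < |z| := not_le.1 hz
      rw [min_eq_left ((one_lt_sq_iff_one_lt_abs z).2 hz').le, mul_one, add_zero]
      exact hlarge hz'
end

section
/- Diagonal approximation of the potential via mollified transition densities: let T > 0 and let p, p_m : [0,T] × ℝ^n × ℝ^n → [0,∞) (m ≥ 1) be measurable functions such that ∫ p_m(t,x,y) dy = ∫ p(t,x,y) dy = 1 for all (t,x). Assume: (i) p_m → p as m → ∞, uniformly on every compact subset of [0,T] × ℝ^n × ℝ^n; (ii) there exist compact sets D_k ⊆ ℝ^n (k ≥ 1) with positive Lebesgue measure such that sup_m sup_{t∈[0,T], |x|≤k} ∫_{D_k^c} p_m(t,x,y) dy ≤ 1/k³ and sup_{t∈[0,T], |x|≤k} ∫_{D_k^c} p(t,x,y) dy ≤ 1/k³; (iii) (g_k) are measurable functions with |g_k| ≤ k such that h_k(t,x) := ∫ g_k(y) p(t,x,y) dy converges pointwise on [0,T]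 × ℝ^n to a function h(t,x). Then there exists a subsequence (m_k)_{k≥1} such that h_k^{(m_k)}(t,x) := ∫ g_k(y) p_{m_k}(t,x,y) dy converges to h(t,x) for every (t,x) ∈ [0,T] × ℝ^n. -/
open MeasureTheory Filter
open scoped ENNReal Topology

/-- Integrals of a bounded function against two nonnegative densities which are uniformly close
on a set of finite measure differ by at most the local error plus the masses off that set. -/
theorem abs_integral_mul_sub_integral_mul_le {α : Type*} [MeasurableSpace α] {μ : Measure α}
    {f q g : α → ℝ} {s : Set α} {C ε : ℝ} (hs : MeasurableSet s) (hμs : μ s ≠ ∞)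
    (hf : Integrable f μ) (hq : Integrable q μ) (hf0 : ∀ y, 0 ≤ f y) (hq0 : ∀ y, 0 ≤ q y)
    (hg : AEStronglyMeasurable g μ) (hC : 0 ≤ C) (hgC : ∀ y, |g y| ≤ C)
    (hε : ∀ y ∈ s, |f y - q y| ≤ ε) :
    |∫ y, g y * f y ∂μ - ∫ y, g y * q y ∂μ| ≤
      C * (ε * μ.real s + (∫ y in sᶜ, f y ∂μ + ∫ y in sᶜ, q y ∂μ)) := by
  have hgb : ∀ᵐ y ∂μ, ‖g y‖ ≤ C := .of_forall hgC
  have hd : Integrable (fun y => |f y - q y|) μ := (hf.sub hq).abs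
  have hin : ∫ y in s, |f y - q y| ∂μ ≤ ε * μ.real s := by
    calc ∫ y in s, |f y - q y| ∂μ ≤ ∫ _ in s, ε ∂μ :=
          setIntegral_mono_on hd.integrableOn (integrableOn_const hμs) hs hε
      _ = ε * μ.real s := by rw [setIntegral_const, smul_eq_mul, mul_comm]
  have hout : ∫ y in sᶜ, |f y - q y| ∂μ ≤ ∫ y in sᶜ, f y ∂μ + ∫ y in sᶜ, q y ∂μ := by
    rw [← integral_add hf.integrableOn hq.integrableOn]
    refine setIntegral_mono hd.integrableOn (hf.add hq).integrableOn fun y => ?_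
    have h₁ := hf0 y
    have h₂ := hq0 y
    exact abs_le.2 ⟨by linarith, by linarith⟩
  rw [← integral_sub (hf.bdd_mul hg hgb) (hq.bdd_mul hg hgb)]
  calc |∫ y, (g y * f y - g y * q y) ∂μ| ≤ ∫ y, C * |f y - q y| ∂μ := by
        rw [← Real.norm_eq_abs]
        refine norm_integral_le_of_norm_le (hd.const_mul C) (.of_forall fun y => ?_)
        rw [← mul_sub, norm_mul]
        exact mul_le_mul_of_nonneg_right (hgC y) (abs_nonneg _)
    _ = C * (∫ y in s, |f y - q y| ∂μ + ∫ y in sᶜ, |f y - q y| ∂μ) := by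
        rw [integral_const_mul, integral_add_compl hs hd]
    _ ≤ _ := mul_le_mul_of_nonneg_left (add_le_add hin hout) hC

/-- diagonal approximation of the potential via mollified
transition densities.  If `p_m → p` uniformly on compacts, the mass of `p_m, p`
outside compacts `D_k` is uniformly small, and `h_k(t,x) = ∫ g_k(y) p(t,x,y) dy`
converges pointwise to `h(t,x)`, then along a subsequence `(m_k)` one has
`∫ g_k(y) p_{m_k}(t,x,y) dy → h(t,x)` for every `(t,x) ∈ [0,T] × ℝⁿ`. -/
theorem diagonal_approximation_potential {n : ℕ} (T : ℝ) (hT : 0 < T)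
    (p : ℝ → (Fin n → ℝ) → (Fin n → ℝ) → ℝ)
    (pm : ℕ → ℝ → (Fin n → ℝ) → (Fin n → ℝ) → ℝ)
    (hpmeas : Measurable (fun q : ℝ × (Fin n → ℝ) × (Fin n → ℝ) => p q.1 q.2.1 q.2.2))
    (hpmmeas : ∀ m, Measurable
      (fun q : ℝ × (Fin n → ℝ) × (Fin n → ℝ) => pm m q.1 q.2.1 q.2.2))
    (hpnonneg : ∀ t x y, 0 ≤ p t x y)
    (hpmnonneg : ∀ m t x y, 0 ≤ pm m t x y)
    -- normalization: the densities integrate to one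
    (hpnorm : ∀ t x, t ∈ Set.Icc 0 T → ∫ y, p t x y = 1)
    (hpmnorm : ∀ m t x, t ∈ Set.Icc 0 T → ∫ y, pm m t x y = 1)
    -- (i) p_m → p uniformly on every compact subset of [0,T] × ℝⁿ × ℝⁿ
    (hunif : ∀ K : Set (ℝ × (Fin n → ℝ) × (Fin n → ℝ)), IsCompact K →
      K ⊆ {q | q.1 ∈ Set.Icc 0 T} →
      TendstoUniformlyOn (fun m q => pm m q.1 q.2.1 q.2.2)
        (fun q => p q.1 q.2.1 q.2.2) atTop K)
    -- (ii) tightness: compact sets D_k carrying all but 1/k³ of the mass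
    (D : ℕ → Set (Fin n → ℝ))
    (hDcompact : ∀ k, IsCompact (D k))
    (hDpos : ∀ k, 0 < volume (D k))
    (hDm : ∀ k : ℕ, 1 ≤ k → ∀ m, ∀ t ∈ Set.Icc (0 : ℝ) T, ∀ x : Fin n → ℝ, ‖x‖ ≤ k →
      ∫ y in (D k)ᶜ, pm m t x y ≤ 1 / (k : ℝ) ^ 3)
    (hDp : ∀ k : ℕ, 1 ≤ k → ∀ t ∈ Set.Icc (0 : ℝ) T, ∀ x : Fin n → ℝ, ‖x‖ ≤ k →
      ∫ y in (D k)ᶜ, p t x y ≤ 1 / (k : ℝ) ^ 3)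
    -- (iii) bounded g_k with h_k(t,x) = ∫ g_k p(t,x,·) → h(t,x) pointwise
    (g : ℕ → (Fin n → ℝ) → ℝ)
    (hgmeas : ∀ k, Measurable (g k))
    (hgbdd : ∀ k : ℕ, 1 ≤ k → ∀ y, |g k y| ≤ (k : ℝ))
    (h : ℝ → (Fin n → ℝ) → ℝ)
    (hconv : ∀ t ∈ Set.Icc (0 : ℝ) T, ∀ x,
      Tendsto (fun k => ∫ y, g k y * p t x y) atTop (𝓝 (h t x))) :
    ∃ mk : ℕ → ℕ, StrictMono mk ∧
      ∀ t ∈ Set.Icc (0 : ℝ) T, ∀ x,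
        Tendsto (fun k => ∫ y, g k y * pm (mk k) t x y) atTop (𝓝 (h t x)) := by
  have hp : ∀ t ∈ Set.Icc (0 : ℝ) T, ∀ x, Integrable (p t x) := fun t ht x =>
    .of_integral_ne_zero (by rw [hpnorm t x ht]; exact one_ne_zero)
  have hpm : ∀ m, ∀ t ∈ Set.Icc (0 : ℝ) T, ∀ x, Integrable (pm m t x) := fun m t ht x =>
    .of_integral_ne_zero (by rw [hpmnorm m t x ht]; exact one_ne_zero)
  let ε : ℕ → ℝ := fun k => 1 / ((volume.real (D k) + 1) * ((k : ℝ) + 1) ^ 2)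
  have hεpos : ∀ k, 0 < ε k := fun k => by positivity
  have hev : ∀ k : ℕ, ∀ᶠ m in atTop, ∀ t ∈ Set.Icc (0 : ℝ) T, ∀ x : Fin n → ℝ, ‖x‖ ≤ k →
      ∀ y ∈ D k, |pm m t x y - p t x y| ≤ ε k := by
    intro k
    have hK := hunif (Set.Icc 0 T ×ˢ Metric.closedBall 0 (k : ℝ) ×ˢ D k)
      (isCompact_Icc.prod ((isCompact_closedBall _ _).prod (hDcompact k))) fun q hq => hq.1
    filter_upwards [Metric.tendstoUniformlyOn_iff.1 hK (ε k) (hεpos k)] with m hm t ht x hx y hy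
    have hlt := hm (t, x, y) ⟨ht, mem_closedBall_zero_iff.2 hx, hy⟩
    rw [dist_comm, Real.dist_eq] at hlt
    exact hlt.le
  obtain ⟨mk, hmk, hclose⟩ := extraction_forall_of_eventually hev
  refine ⟨mk, hmk, fun t ht x => ?_⟩
  have hbound : ∀ᶠ k : ℕ in atTop,
      ‖(∫ y, g k y * pm (mk k) t x y) - ∫ y, g k y * p t x y‖ ≤ 3 / (k : ℝ) := by
    filter_upwards [eventually_ge_atTop 1, eventually_ge_atTop ⌈‖x‖⌉₊] with k hk hkx
    have hx : ‖x‖ ≤ k := Nat.ceil_le.1 hkx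
    have hk' : (1 : ℝ) ≤ k := by exact_mod_cast hk
    have hk₀ : (0 : ℝ) < k := by linarith
    have hin : ε k * volume.real (D k) ≤ 1 / (k : ℝ) ^ 2 := by
      have hv : 0 ≤ volume.real (D k) := measureReal_nonneg
      rw [one_div_mul_eq_div, div_le_div_iff₀ (by positivity) (by positivity), one_mul]
      gcongr <;> linarith
    have hcube : 1 / (k : ℝ) ^ 3 ≤ 1 / (k : ℝ) ^ 2 :=
      one_div_le_one_div_of_le (by positivity) (pow_le_pow_right₀ hk' (by norm_num))
    have hsum : ε k * volume.real (D k) +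
        ((∫ y in (D k)ᶜ, pm (mk k) t x y) + ∫ y in (D k)ᶜ, p t x y) ≤ 3 / (k : ℝ) ^ 2 := by
      have h₁ := hDm k hk (mk k) t ht x hx
      have h₂ := hDp k hk t ht x hx
      have h₃ : 3 / (k : ℝ) ^ 2 = 3 * (1 / (k : ℝ) ^ 2) := by ring
      linarith
    calc ‖(∫ y, g k y * pm (mk k) t x y) - ∫ y, g k y * p t x y‖
        ≤ k * (ε k * volume.real (D k) +
            ((∫ y in (D k)ᶜ, pm (mk k) t x y) + ∫ y in (D k)ᶜ, p t x y)) :=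
          abs_integral_mul_sub_integral_mul_le (hDcompact k).measurableSet
            (hDcompact k).measure_lt_top.ne (hpm (mk k) t ht x) (hp t ht x)
            (hpmnonneg (mk k) t x) (hpnonneg t x) (hgmeas k).aestronglyMeasurable hk₀.le
            (hgbdd k hk) (hclose k t ht x hx)
      _ ≤ k * (3 / (k : ℝ) ^ 2) := mul_le_mul_of_nonneg_left hsum hk₀.le
      _ = 3 / (k : ℝ) := by field_simp
  simpa using
    (squeeze_zero_norm' hbound (tendsto_const_div_atTop_nhds_zero_nat 3)).add (hconv t ht x)
end
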